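/- arXiv:2208.13610 — 4 statements merged into one kernel-verified Lean document; each statement's English description precedes it below -/
import Mathlib

section
/- Let γ = {γ_u} be strictly positive weights, let N, s ∈ ℕ, and let z = (z_1,…,z_s) ∈ ℤ^s satisfy gcd(z_j, N) = 1 for all j ∈ {1,…,s}. Then for every α > 1, e_{N,s,α,γ}(z) − T_{α,γ}(N,z) ≤ (1/N^α) · Σ_{∅≠u⊆{1,…,s}} γ_u (4ζ(α))^{|u|}, where ζ is the Riemann zeta function. -/
open Finset MeasureTheory

noncomputable section

/-- `lsin a = log (1 / sin² (π a))`. -/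
def lsin (a : ℝ) : ℝ := Real.log (1 / Real.sin (Real.pi * a) ^ 2)

/-- The support of `m ∈ ℤ^s`, viewed as a subset of `{1,…,s} ⊂ ℕ`
(component `j : Fin s` corresponds to the index `j+1 ∈ {1,…,s}`). -/
def msupp {s : ℕ} (m : Fin s → ℤ) : Finset ℕ :=
  (Finset.univ.filter fun j => m j ≠ 0).image fun j : Fin s => (j : ℕ) + 1

/-- `r_{α,γ}(m) = γ_{supp(m)}⁻¹ ∏_{j ∈ supp(m)} |m_j|^α`. -/
def rweight {s : ℕ} (α : ℝ) (γ : Finset ℕ → ℝ) (m : Fin s → ℤ) : ℝ :=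
  (γ (msupp m))⁻¹ * ∏ j ∈ Finset.univ.filter (fun j => m j ≠ 0), |(m j : ℝ)| ^ α

/-- The truncated quantity
`T_{α,γ}(N,z) = ∑_{m ∈ M_{N,s}\{0}, m·z ≡ 0 (mod N)} 1 / r_{α,γ}(m)`,
where `M_{N,s} = {-(N-1),…,N-1}^s` and the components of `z` are `z 1, …, z s`. -/
def Tsum (α : ℝ) (γ : Finset ℕ → ℝ) (N s : ℕ) (z : ℕ → ℤ) : ℝ :=
  ∑ m ∈ (Fintype.piFinset fun _ : Fin s => Finset.Icc (-(N : ℤ) + 1) ((N : ℤ) - 1)).filter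
      (fun m => m ≠ 0 ∧ (∑ j : Fin s, m j * z ((j : ℕ) + 1)) % (N : ℤ) = 0),
    1 / rweight α γ m

/-- `H_{s,n,γ}(z) = ∑_{k=1}^{2^n-1} ∑_{∅≠u⊆{1,…,s}} γ_u ∏_{j∈u} log(1/sin²(π k z_j/2^n))`. -/
def Hsum (γ : Finset ℕ → ℝ) (s n : ℕ) (z : ℕ → ℤ) : ℝ :=
  ∑ k ∈ Finset.Icc (1:ℕ) (2 ^ n - 1),
    ∑ u ∈ (Finset.Icc 1 s).powerset.filter (· ≠ ∅),
      γ u * ∏ j ∈ u, lsin ((k : ℝ) * (z j : ℝ) / 2 ^ n)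

/-- The digit-wise quality function `h_{r,n,v,γ}(x)` (with previously chosen
components `z 1, …, z (r-1)`). -/
def hqual (γ : Finset ℕ → ℝ) (n v r : ℕ) (z : ℕ → ℤ) (x : ℤ) : ℝ :=
  ∑ t ∈ Finset.Icc v n, (1 / 2 ^ (t - v) : ℝ) *
    ∑ k ∈ (Finset.Icc (1:ℕ) (2 ^ t - 1)).filter (fun k => Odd k),
      ((∑ u ∈ (Finset.Icc 1 (r - 1)).powerset.filter (· ≠ ∅),
          γ u * ∏ j ∈ u, lsin ((k : ℝ) * (z j : ℝ) / 2 ^ t)) +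
        ∑ u ∈ (Finset.Icc 1 (r - 1)).powerset,
          γ (u ∪ {r}) * lsin ((k : ℝ) * (x : ℝ) / 2 ^ v) *
            ∏ j ∈ u, lsin ((k : ℝ) * (z j : ℝ) / 2 ^ t))

/-- `z = (z 1, …, z s)` is (a possible) output of the component-by-component
digit-by-digit construction (Algorithm 1) with inputs `n`, `s` and weights `γ`:
`z 1 = 1`, and for `r = 2,…,s` one has `z_{r,1} = 1` and for `v = 2,…,n`,
`z_{r,v} = z_{r,v-1} + z* 2^{v-1}` where `z* ∈ {0,1}` minimizes
`z ↦ h_{r,n,v,γ}(z_{r,v-1} + z 2^{v-1})`; finally `z r = z_{r,n}`. -/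
def IsCBCDBD (γ : Finset ℕ → ℝ) (n s : ℕ) (z : ℕ → ℤ) : Prop :=
  z 1 = 1 ∧
  ∃ zz : ℕ → ℕ → ℤ,
    ∀ r ∈ Finset.Icc 2 s, zz r 1 = 1 ∧ z r = zz r n ∧
      ∀ v ∈ Finset.Icc 2 n, ∃ zs ∈ ({0, 1} : Set ℤ),
        zz r v = zz r (v - 1) + zs * 2 ^ (v - 1) ∧
        ∀ w ∈ ({0, 1} : Set ℤ),
          hqual γ n v r z (zz r (v - 1) + zs * 2 ^ (v - 1)) ≤
            hqual γ n v r z (zz r (v - 1) + w * 2 ^ (v - 1))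

/-- The weights `γ ∪ v`, i.e. `(γ ∪ v)_u = γ_{u ∪ v}`. -/
def unionWeights (γ : Finset ℕ → ℝ) (v : Finset ℕ) : Finset ℕ → ℝ :=
  fun u => γ (u ∪ v)

/-- `γ̃_j = max_{v ⊆ {1,…,j-1}} γ_{v ∪ {j}} / γ_v`. -/
def tildeW (γ : Finset ℕ → ℝ) (j : ℕ) : ℝ :=
  (Finset.Icc 1 (j - 1)).powerset.sup' ⟨∅, Finset.empty_mem_powerset _⟩
    fun v => γ (insert j v) / γ v

/-- The unit cube `[0,1]^s`. -/
def cube (s : ℕ) : Set (Fin s → ℝ) := Set.univ.pi fun _ => Set.Icc 0 1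

/-- The Fourier coefficient `f̂(m) = ∫_{[0,1]^s} f(x) e^{-2πi m·x} dx`. -/
def fcoeff (s : ℕ) (f : (Fin s → ℝ) → ℂ) (m : Fin s → ℤ) : ℂ :=
  ∫ x in cube s,
    f x * Complex.exp (-(2 * (Real.pi : ℂ) * Complex.I) * ∑ j, (m j : ℂ) * (x j : ℂ))

/-- The rank-1 lattice rule `Q_{N,s}(f,z) = (1/N) ∑_{k=0}^{N-1} f({k z / N})`. -/
def qmc (N s : ℕ) (z : ℕ → ℤ) (f : (Fin s → ℝ) → ℂ) : ℂ :=
  (N : ℂ)⁻¹ * ∑ k ∈ Finset.range N,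
    f fun j => Int.fract ((k : ℝ) * (z ((j : ℕ) + 1) : ℝ) / (N : ℝ))

/-- The worst-case error `e_{N,s,α,γ}(z)` of the rank-1 lattice rule with generating
vector `z` in the unit ball of the space `E^α_{s,γ}` (whose elements are identified
with their continuous representatives). -/
def wce (N s : ℕ) (α : ℝ) (γ : Finset ℕ → ℝ) (z : ℕ → ℤ) : ℝ :=
  ⨆ f ∈ {f : (Fin s → ℝ) → ℂ |
      Continuous f ∧ ∀ m : Fin s → ℤ, ‖fcoeff s f m‖ * rweight α γ m ≤ 1},
    ‖(∫ x in cube s, f x) - qmc N s z f‖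

/-- For POD weights given by `(Γ_ℓ)` and `(γ_j)`:
`p_{m,ℓ,t}(k) = ∑_{u ⊆ {1,…,m}, |u| = ℓ} Γ_ℓ ∏_{j∈u} γ_j log(1/sin²(π k z_j/2^t))`. -/
def psum (Γ γw : ℕ → ℝ) (z : ℕ → ℤ) (m ℓ t : ℕ) (k : ℕ) : ℝ :=
  ∑ u ∈ (Finset.Icc 1 m).powerset.filter (fun u => u.card = ℓ),
    Γ ℓ * ∏ j ∈ u, γw j * lsin ((k : ℝ) * (z j : ℝ) / 2 ^ t)

section AuxLemmas
open scoped ENNReal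

lemma aux_tsum_pi (k : ℕ) (g : Fin k → ℤ → ℝ≥0∞) :
    ∑' m : Fin k → ℤ, ∏ i, g i (m i) = ∏ i, ∑' n, g i n := by
  induction k with
  | zero => simp [tsum_fintype]
  | succ k ih =>
    rw [← (Fin.insertNthEquiv (fun _ => ℤ) (0 : Fin (k+1))).tsum_eq, ENNReal.tsum_prod']
    simp only [Fin.prod_univ_succAbove _ (0 : Fin (k+1)), Fin.insertNthEquiv, Equiv.coe_fn_mk, Fin.insertNth_apply_same,
      Fin.insertNth_apply_succAbove]
    simp_rw [ENNReal.tsum_mul_left, ENNReal.tsum_mul_right]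
    rw [ih]

noncomputable def auxw (α : ℝ) (n : ℤ) : ℝ≥0∞ := if n = 0 then 0 else ENNReal.ofReal (|(n:ℝ)| ^ (-α))

lemma aux_inner (α : ℝ) (hα : 1 < α) (N : ℕ) (hN : 1 ≤ N) (z c : ℤ) (hz : Int.gcd z N = 1) :
    ∑' n : ℤ, (if (N : ℤ) ∣ n * z + c ∧ (N : ℤ) ≤ |n| then auxw α n else 0) ≤
      ENNReal.ofReal ((N : ℝ) ^ (-α)) * ∑' n, auxw α n := by
  have hN0 : (0 : ℤ) < N := by exact_mod_cast hN
  set S : Set ℤ := {n | (N : ℤ) ∣ n * z + c ∧ (N : ℤ) ≤ |n|} with hS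
  have h1 : ∑' n : ℤ, (if (N : ℤ) ∣ n * z + c ∧ (N : ℤ) ≤ |n| then auxw α n else 0) =
      ∑' n : S, auxw α n := by
    rw [_root_.tsum_subtype]; apply tsum_congr; intro n
    simp only [Set.indicator, hS, Set.mem_ofPred_eq]
  rw [h1, ← ENNReal.tsum_mul_left]
  have hinj : Function.Injective (fun n : S => (n : ℤ).tdiv N) := by
    rintro ⟨a, ha1, ha2⟩ ⟨b, hb1, hb2⟩ h
    simp only at h
    have hd : (N : ℤ) ∣ a - b := by
      have : (N : ℤ) ∣ (a - b) * z := by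
        have := dvd_sub ha1 hb1
        rwa [show a * z + c - (b * z + c) = (a - b) * z by ring] at this
      exact (Int.isCoprime_iff_gcd_eq_one.mpr hz).symm.dvd_of_dvd_mul_right this
    obtain ⟨t, ht⟩ := hd
    have e1 := Int.mul_tdiv_add_tmod a N
    have e2 := Int.mul_tdiv_add_tmod b N
    rw [h] at e1
    have l1 := Int.tmod_lt_of_pos a hN0
    have l2 := Int.tmod_lt_of_pos b hN0
    have l3 := Int.lt_tmod_of_pos a hN0
    have l4 := Int.lt_tmod_of_pos b hN0
    have s1 : 0 ≤ a → 0 ≤ a.tmod N := fun h => Int.tmod_nonneg _ h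
    have s2 : 0 ≤ b → 0 ≤ b.tmod N := fun h => Int.tmod_nonneg _ h
    have s3 : a ≤ 0 → a.tmod N ≤ 0 := fun h => by
      have := Int.tmod_nonneg (N:ℤ) (neg_nonneg.mpr h); rw [Int.neg_tmod] at this; omega
    have s4 : b ≤ 0 → b.tmod N ≤ 0 := fun h => by
      have := Int.tmod_nonneg (N:ℤ) (neg_nonneg.mpr h); rw [Int.neg_tmod] at this; omega
    have key : a.tmod N - b.tmod N = N * t := by linarith
    have q : ∀ x : ℤ, (N:ℤ) * t = x → -N < x → x < N → t = 0 := by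
      intro x hx h1 h2
      subst hx
      have : t < 1 := by nlinarith
      have : -1 < t := by nlinarith
      omega
    have qq : t = 0 := by
      generalize b.tdiv N = Q at *
      have : (0 ≤ a ∧ 0 ≤ b) ∨ (a ≤ 0 ∧ b ≤ 0) := by
        rcases le_total 0 a with h0 | h0 <;> rcases le_total 0 b with h1 | h1
        · left; exact ⟨h0,h1⟩
        · exfalso
          rw [abs_of_nonneg h0] at ha2; rw [abs_of_nonpos h1] at hb2
          have : 0 < (N:ℤ) * Q := by linarith
          have : (N:ℤ) * Q < 0 := by linarith
          omega
        · exfalso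
          rw [abs_of_nonpos h0] at ha2; rw [abs_of_nonneg h1] at hb2
          have : 0 < (N:ℤ) * Q := by linarith
          have : (N:ℤ) * Q < 0 := by linarith
          omega
        · right; exact ⟨h0,h1⟩
      rcases this with ⟨p, r⟩ | ⟨p, r⟩
      · have := s1 p; have := s2 r; exact q _ key.symm (by omega) (by omega)
      · have := s3 p; have := s4 r; exact q _ key.symm (by omega) (by omega)
    subst qq
    simp only [mul_zero] at ht
    exact Subtype.ext (by show a = b; omega)
  refine le_trans ?_ (ENNReal.tsum_comp_le_tsum_of_injective hinj _)
  apply ENNReal.tsum_le_tsum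
  rintro ⟨n, hn1, hn2⟩
  simp only
  have hn0 : n ≠ 0 := by rintro rfl; simp at hn2; omega
  have habs : |n.tdiv N| * N ≤ |n| ∧ n.tdiv N ≠ 0 := by
    have e : |n.tdiv N| = |n| / N := by
      rw [Int.abs_eq_natAbs, Int.natAbs_tdiv, Int.abs_eq_natAbs]; simp only [Int.natAbs_natCast]; exact Int.natCast_div _ _
    constructor
    · rw [e]; exact Int.ediv_mul_le _ hN0.ne'
    · rw [← abs_pos, e]
      exact Int.lt_of_lt_of_le one_pos (Int.le_ediv_of_mul_le hN0 (by simpa using hn2))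
  rw [auxw, auxw, if_neg hn0, if_neg habs.2, ← ENNReal.ofReal_mul (by positivity)]
  apply ENNReal.ofReal_le_ofReal
  have hN' : (0:ℝ) < N := by exact_mod_cast hN
  rw [← Real.mul_rpow hN'.le (abs_nonneg _)]
  apply Real.rpow_le_rpow_of_nonpos 
  · have : (0:ℝ) < |((n.tdiv N : ℤ):ℝ)| := abs_pos.mpr (by exact_mod_cast habs.2)
    positivity
  · rw [mul_comm]; exact_mod_cast habs.1
  · linarith

lemma aux_W (α : ℝ) (hα : 1 < α) :
    ∑' n, auxw α n = ENNReal.ofReal (2 * (riemannZeta (α : ℂ)).re) := by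
  have hz : (riemannZeta (α : ℂ)).re = ∑' n : ℕ, ((n:ℝ)+1) ^ (-α) := by
    rw [zeta_eq_tsum_one_div_nat_add_one_cpow (by simpa using hα)]
    rw [← Complex.ofReal_re (∑' n : ℕ, ((n:ℝ)+1) ^ (-α)), Complex.ofReal_tsum]
    congr 1
    apply tsum_congr; intro n
    rw [Complex.ofReal_cpow (by positivity)]
    push_cast
    rw [Complex.cpow_neg, one_div]
  have hs : Summable (fun n : ℕ => ((n:ℝ)+1) ^ (-α)) := by
    have := (summable_nat_add_iff 1).mpr (Real.summable_nat_rpow.mpr (show -α < -1 by linarith))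
    simpa using this
  have e : ∑' n : ℕ, ENNReal.ofReal (((n:ℝ)+1) ^ (-α)) = ENNReal.ofReal (riemannZeta (α : ℂ)).re := by
    rw [hz, ENNReal.ofReal_tsum_of_nonneg _ hs]
    intro n; positivity
  rw [tsum_of_nat_of_neg_add_one ENNReal.summable ENNReal.summable, tsum_eq_zero_add' ENNReal.summable]
  rw [ENNReal.ofReal_mul (by norm_num), ← e]
  have e1 : ∀ n : ℕ, auxw α ((n+1 : ℕ) : ℤ) = ENNReal.ofReal (((n:ℝ)+1) ^ (-α)) := by
    intro n
    rw [auxw, if_neg (by omega)]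
    congr 2; push_cast; rw [abs_of_nonneg (by positivity)]
  have e2 : ∀ n : ℕ, auxw α (-((n : ℤ)+1)) = ENNReal.ofReal (((n:ℝ)+1) ^ (-α)) := by
    intro n
    rw [auxw, if_neg (by omega)]
    congr 2; push_cast; rw [abs_of_nonpos (by linarith)]; ring
  simp_rw [e1, e2]
  have e0 : auxw α ((0:ℕ):ℤ) = 0 := by simp [auxw]
  rw [e0, zero_add, ← two_mul]
  simp

section FourierPart
attribute [local instance] instMeasureSpaceUnitAddCircle

lemma aux_prob : IsProbabilityMeasure (volume : Measure UnitAddCircle) :=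
  inferInstanceAs (IsProbabilityMeasure AddCircle.haarAddCircle)
attribute [local instance] aux_prob

def auxmk {s : ℕ} (x : Fin s → ℝ) : UnitAddTorus (Fin s) := fun i => (x i : UnitAddCircle)

lemma aux_mFourier {s : ℕ} (n : Fin s → ℤ) (x : Fin s → ℝ) :
    UnitAddTorus.mFourier n (auxmk x) =
      Complex.exp ((2 * (Real.pi : ℂ) * Complex.I) * ∑ j, (n j : ℂ) * (x j : ℂ)) := by
  simp only [UnitAddTorus.mFourier, ContinuousMap.coe_mk, auxmk, fourier_coe_apply]
  rw [← Complex.exp_sum, Finset.mul_sum]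
  congr 1
  apply Finset.sum_congr rfl
  intro i _
  push_cast
  ring

def auxcube (s : ℕ) : Set (Fin s → ℝ) := {x | ∀ i, x i ∈ Set.Ioc (0:ℝ) (0 + 1)}

lemma aux_cube_ae (s : ℕ) : auxcube s =ᵐ[volume] cube s := by
  have h := Measure.univ_pi_Ioc_ae_eq_Icc (μ := fun _ : Fin s => (volume : Measure ℝ))
    (f := fun _ => 0) (g := fun _ => 1)
  have e1 : auxcube s = Set.univ.pi fun _ => Set.Ioc (0:ℝ) 1 := by
    ext x; simp [auxcube]
  have e2 : cube s = Set.Icc (fun _ => 0) (fun _ => 1) := by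
    rw [cube, Set.pi_univ_Icc]
  rw [e1, e2]; exact h

/-- A measurable lift of `f` to the torus. -/
def auxF {s : ℕ} (f : (Fin s → ℝ) → ℂ) (y : UnitAddTorus (Fin s)) : ℂ :=
  f (UnitAddTorus.measurableEquivPiIoc (fun _ : Fin s => (0:ℝ)) y).1

lemma auxF_mk {s : ℕ} (f : (Fin s → ℝ) → ℂ) (x : Fin s → ℝ) (hx : x ∈ auxcube s) :
    auxF f (auxmk x) = f x := by
  have : auxmk x = (UnitAddTorus.measurableEquivPiIoc (fun _ : Fin s => (0:ℝ))).symm ⟨x, hx⟩ := rfl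
  rw [auxF, this, MeasurableEquiv.apply_symm_apply]

lemma aux_memLp {s : ℕ} (f : (Fin s → ℝ) → ℂ) (hf : Continuous f) :
    MemLp (auxF f) 2 (volume : Measure (UnitAddTorus (Fin s))) := by
  have hc : IsCompact (cube s) := isCompact_univ_pi fun _ => isCompact_Icc
  obtain ⟨C, hC⟩ := hc.exists_bound_of_continuousOn hf.continuousOn
  apply MemLp.of_bound _ C
  · refine Filter.Eventually.of_forall fun y => hC _ ?_
    intro i _
    have := (UnitAddTorus.measurableEquivPiIoc (fun _ : Fin s => (0:ℝ)) y).2 i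
    exact ⟨this.1.le, by simpa using this.2⟩
  · apply Measurable.aestronglyMeasurable
    exact hf.measurable.comp (measurable_subtype_coe.comp
      (UnitAddTorus.measurableEquivPiIoc (fun _ : Fin s => (0:ℝ))).measurable)

lemma aux_coeff {s : ℕ} (f : (Fin s → ℝ) → ℂ) (m : Fin s → ℤ) :
    UnitAddTorus.mFourierCoeff (auxF f) m = fcoeff s f m := by
  rw [UnitAddTorus.mFourierCoeff_eq_integral _ _ (fun _ => 0), fcoeff,
    ← setIntegral_congr_set (aux_cube_ae s)]
  apply setIntegral_congr_fun
  · have e1 : {x : Fin s → ℝ | ∀ i, x i ∈ Set.Ioc (0:ℝ) (0+1)} = Set.univ.pi fun _ => Set.Ioc (0:ℝ) 1 := by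
      ext x; simp
    rw [e1]
    exact MeasurableSet.univ_pi fun _ => measurableSet_Ioc
  · intro x hx
    have h1 := aux_mFourier (-m) x
    have h2 := auxF_mk f x hx
    change UnitAddTorus.mFourier (-m) (auxmk x) • auxF f (auxmk x) = _
    rw [h1, h2, smul_eq_mul]
    rw [mul_comm]
    congr 2
    simp

theorem aux_fourier {s : ℕ} (f : (Fin s → ℝ) → ℂ) (hf : Continuous f)
    (hsum : Summable (fun m => ‖fcoeff s f m‖)) (x : Fin s → ℝ) (hx : x ∈ cube s) :
    HasSum (fun m => fcoeff s f m *
      Complex.exp ((2 * (Real.pi : ℂ) * Complex.I) * ∑ j, (m j : ℂ) * (x j : ℂ))) (f x) := by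
  have hF := aux_memLp f hf
  have hL2 := UnitAddTorus.hasSum_mFourier_series_L2 hF.toLp
  have hco : ∀ m, UnitAddTorus.mFourierCoeff hF.toLp m = fcoeff s f m := by
    intro m
    rw [← aux_coeff]
    apply integral_congr_ae
    filter_upwards [hF.coeFn_toLp] with y hy
    rw [hy]
  simp_rw [hco] at hL2
  have hS : Summable (fun m => fcoeff s f m • UnitAddTorus.mFourier (d := Fin s) m) := by
    apply Summable.of_norm
    simpa only [norm_smul, UnitAddTorus.mFourier_norm, mul_one] using hsum
  obtain ⟨g, hg⟩ := hS
  have hg2 : HasSum (fun m => fcoeff s f m • UnitAddTorus.mFourierLp (d := Fin s) 2 m)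
      (ContinuousMap.toLp (E := ℂ) 2 volume ℂ g) := by
    have := (ContinuousMap.toLp (E := ℂ) 2 (volume : Measure (UnitAddTorus (Fin s))) ℂ).hasSum hg
    simpa only [map_smul] using this
  have heq := hg2.unique hL2
  have hae : auxF f =ᵐ[volume] g := by
    have h1 := ContinuousMap.coeFn_toLp (𝕜 := ℂ) (p := 2) (volume : Measure (UnitAddTorus (Fin s))) g
    rw [heq] at h1
    exact hF.coeFn_toLp.symm.trans h1
  have hmk : Continuous (auxmk (s := s)) := by
    apply continuous_pi; intro i
    exact (AddCircle.continuous_mk' 1).comp (continuous_apply i)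
  have hzero : ∫⁻ y : UnitAddTorus (Fin s), ‖auxF f y - g y‖ₑ = 0 := by
    rw [lintegral_congr_ae (g := fun _ => 0)]
    · simp
    · filter_upwards [hae] with y hy
      simp [hy]
  have hmeas : MeasurableSet (auxcube s) := by
    have e1 : auxcube s = Set.univ.pi fun _ => Set.Ioc (0:ℝ) 1 := by
      ext x; simp [auxcube]
    rw [e1]
    exact MeasurableSet.univ_pi fun _ => measurableSet_Ioc
  rw [UnitAddTorus.lintegral_preimage _ (fun _ => 0)] at hzero
  have hz2 : ∫⁻ x in auxcube s, ‖f x - g (auxmk x)‖ₑ = 0 := by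
    rw [← hzero]
    apply setLIntegral_congr_fun hmeas
    intro x hx
    have h2 := auxF_mk f x hx
    change _ = ‖auxF f (auxmk x) - g (auxmk x)‖ₑ
    simp only [h2]
  have hcont : Continuous fun x => f x - g (auxmk x) := hf.sub (g.continuous.comp hmk)
  rw [lintegral_eq_zero_iff hcont.enorm.measurable] at hz2
  rw [Measure.restrict_congr_set (aux_cube_ae s)] at hz2
  have hae2 : f =ᵐ[volume.restrict (cube s)] fun x => g (auxmk x) := by
    filter_upwards [hz2] with x hx
    simpa [sub_eq_zero] using hx
  have hon : Set.EqOn f (fun x => g (auxmk x)) (cube s) := by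
    apply Measure.eqOn_of_ae_eq hae2 hf.continuousOn (g.continuous.comp hmk).continuousOn
    rw [cube, interior_pi_set Set.finite_univ]
    simp only [interior_Icc]
    rw [closure_pi_set]
    simp
  rw [hon hx]
  have := (ContinuousMap.evalCLM ℂ (auxmk x)).hasSum hg
  simpa [aux_mFourier] using this
end FourierPart

def auxG {s : ℕ} (α : ℝ) (U : Finset (Fin s)) (i : Fin s) (n : ℤ) : ℝ≥0∞ :=
  if i ∈ U then auxw α n else if n = 0 then 1 else 0

lemma auxG_tsum {s : ℕ} (α : ℝ) (U : Finset (Fin s)) (i : Fin s) :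
    ∑' n, auxG α U i n = if i ∈ U then ∑' n, auxw α n else 1 := by
  unfold auxG
  split_ifs with h
  · rfl
  · simp

lemma auxG_prod {s : ℕ} (α : ℝ) (U : Finset (Fin s)) :
    ∏ i, ∑' n, auxG α U i n = (∑' n, auxw α n) ^ U.card := by
  simp_rw [auxG_tsum]
  rw [Finset.prod_ite_mem, Finset.univ_inter, Finset.prod_const]

lemma aux_B {s : ℕ} (α : ℝ) (hα : 1 < α) (N : ℕ) (hN : 1 ≤ N) (z : ℕ → ℤ)
    (hgcd : ∀ j ∈ Finset.Icc 1 s, Int.gcd (z j) (N : ℤ) = 1) (U : Finset (Fin s)) (j : Fin s)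
    (hj : j ∈ U) :
    ∑' m : Fin s → ℤ, (if (N : ℤ) ∣ ∑ i, m i * z ((i:ℕ) + 1) ∧ (N : ℤ) ≤ |m j| then
      ∏ i, auxG α U i (m i) else 0) ≤
    ENNReal.ofReal ((N : ℝ) ^ (-α)) * (∑' n, auxw α n) ^ U.card := by
  rw [← auxG_prod]
  cases s with
  | zero => exact j.elim0
  | succ k =>
    rw [← (Fin.insertNthEquiv (fun _ => ℤ) j).tsum_eq, ENNReal.tsum_prod', ENNReal.tsum_comm]
    simp only [Fin.prod_univ_succAbove _ j, Fin.sum_univ_succAbove _ j, Fin.insertNthEquiv,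
      Equiv.coe_fn_mk, Fin.insertNth_apply_same, Fin.insertNth_apply_succAbove]
    rw [← aux_tsum_pi, ← mul_assoc, ← ENNReal.tsum_mul_left]
    apply ENNReal.tsum_le_tsum
    intro p
    have hz : Int.gcd (z ((j:ℕ)+1)) N = 1 := hgcd _ (by simp; omega)
    have := aux_inner α hα N hN (z ((j:ℕ)+1)) (∑ x, p x * z ((j.succAbove x : ℕ) + 1)) hz
    refine le_trans (le_of_eq ?_) (mul_le_mul_left (le_trans this (le_of_eq ?_)) _)
    · rw [← ENNReal.tsum_mul_right]
      apply tsum_congr; intro n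
      rw [ite_mul, zero_mul]
      simp only [auxG, if_pos hj]
    · simp only [auxG, if_pos hj]

lemma aux_r {s : ℕ} (α : ℝ) (γ : Finset ℕ → ℝ) (hγ : ∀ u, 0 < γ u) (m : Fin s → ℤ) :
    ENNReal.ofReal (1 / rweight α γ m) =
      ENNReal.ofReal (γ (msupp m)) * ∏ i, auxG α (univ.filter fun j => m j ≠ 0) i (m i) := by
  have h : 1 / rweight α γ m =
      γ (msupp m) * ∏ j ∈ univ.filter (fun j => m j ≠ 0), |(m j : ℝ)| ^ (-α) := by
    rw [rweight, one_div, mul_inv, inv_inv, ← Finset.prod_inv_distrib]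
    congr 1
    apply Finset.prod_congr rfl
    intro i _
    rw [Real.rpow_neg (abs_nonneg _)]
  rw [h, ENNReal.ofReal_mul (hγ _).le, ENNReal.ofReal_prod_of_nonneg (fun i _ => by positivity),
    Finset.prod_filter]
  congr 1
  apply Finset.prod_congr rfl
  intro i _
  by_cases hi : m i = 0 <;> simp [auxG, auxw, hi]

lemma aux_powerset (s : ℕ) (g : Finset ℕ → ℝ≥0∞) :
    ∑ U ∈ (univ : Finset (Finset (Fin s))).filter (· ≠ ∅), g (U.image fun j : Fin s => (j:ℕ) + 1)
    = ∑ u ∈ (Finset.Icc 1 s).powerset.filter (· ≠ ∅), g u := by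
  have hinj : Function.Injective (fun j : Fin s => (j:ℕ)+1) := by
    intro a b h; simp at h; exact Fin.ext h
  have himg : (univ : Finset (Fin s)).image (fun j : Fin s => (j:ℕ)+1) = Finset.Icc 1 s := by
    ext n; simp only [mem_image, mem_univ, true_and, mem_Icc]
    constructor
    · rintro ⟨a, rfl⟩; omega
    · rintro ⟨h1, h2⟩; exact ⟨⟨n-1, by omega⟩, by simp; omega⟩
  apply Finset.sum_bij (fun U _ => U.image fun j : Fin s => (j:ℕ) + 1)
  · intro U hU
    simp only [mem_filter, mem_univ, true_and] at hU
    simp only [mem_filter, mem_powerset, ne_eq, image_eq_empty]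
    refine ⟨?_, hU⟩
    rw [← himg]; exact Finset.image_subset_image (subset_univ _)
  · intro a _ b _ h
    exact Finset.image_injective hinj h
  · intro u hu
    simp only [mem_filter, mem_powerset] at hu
    rw [← himg, Finset.subset_image_iff] at hu
    obtain ⟨⟨U, _, rfl⟩, h⟩ := hu
    refine ⟨U, ?_, rfl⟩
    simpa using h
  · intro _ _; rfl

def auxR (γ : Finset ℕ → ℝ) (N s : ℕ) (α : ℝ) : ℝ := (1 / (N : ℝ) ^ α) *
        ∑ u ∈ (Finset.Icc 1 s).powerset.filter (· ≠ ∅),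
          γ u * (4 * (riemannZeta (α : ℂ)).re) ^ u.card

lemma aux_zeta_nonneg (α : ℝ) (hα : 1 < α) : 0 ≤ (riemannZeta (α : ℂ)).re := by
  have hz : (riemannZeta (α : ℂ)).re = ∑' n : ℕ, ((n:ℝ)+1) ^ (-α) := by
    rw [zeta_eq_tsum_one_div_nat_add_one_cpow (by simpa using hα)]
    rw [← Complex.ofReal_re (∑' n : ℕ, ((n:ℝ)+1) ^ (-α)), Complex.ofReal_tsum]
    congr 1
    apply tsum_congr; intro n
    rw [Complex.ofReal_cpow (by positivity)]
    push_cast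
    rw [Complex.cpow_neg, one_div]
  rw [hz]; exact tsum_nonneg fun n => by positivity

lemma aux_E (γ : Finset ℕ → ℝ) (hγ : ∀ u, 0 < γ u) (N s : ℕ) (hN : 1 ≤ N) (z : ℕ → ℤ)
    (hgcd : ∀ j ∈ Finset.Icc 1 s, Int.gcd (z j) (N : ℤ) = 1) (α : ℝ) (hα : 1 < α) :
    ∑' m : Fin s → ℤ, (if m ≠ 0 ∧ (N : ℤ) ∣ ∑ i, m i * z ((i:ℕ) + 1) then
      ENNReal.ofReal (1 / rweight α γ m) else 0) ≤
    ENNReal.ofReal (Tsum α γ N s z) + ENNReal.ofReal (auxR γ N s α) := by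
  classical
  have hr : ∀ m : Fin s → ℤ, 0 ≤ 1 / rweight α γ m := by
    intro m
    rw [rweight]
    have := hγ (msupp m)
    positivity
  set B := (Fintype.piFinset fun _ : Fin s => Finset.Icc (-(N : ℤ) + 1) ((N : ℤ) - 1)).filter
      (fun m => m ≠ 0 ∧ (∑ j : Fin s, m j * z ((j : ℕ) + 1)) % (N : ℤ) = 0) with hB
  have h1 : ∀ m : Fin s → ℤ, (if m ≠ 0 ∧ (N : ℤ) ∣ ∑ i, m i * z ((i:ℕ) + 1) then
      ENNReal.ofReal (1 / rweight α γ m) else 0) ≤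
      (if m ∈ B then ENNReal.ofReal (1 / rweight α γ m) else 0) +
      ∑ U ∈ (univ : Finset (Finset (Fin s))).filter (· ≠ ∅),
        ENNReal.ofReal (γ (U.image fun j : Fin s => (j:ℕ) + 1)) *
        ∑ j ∈ U, (if (N : ℤ) ∣ ∑ i, m i * z ((i:ℕ) + 1) ∧ (N : ℤ) ≤ |m j| then
          ∏ i, auxG α U i (m i) else 0) := by
    intro m
    split_ifs with hm hmB
    · exact le_self_add
    · rw [zero_add]
      have hj : ∃ j, (N:ℤ) ≤ |m j| := by
        by_contra hcon
        push Not at hcon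
        apply hmB
        rw [hB, mem_filter, Fintype.mem_piFinset]
        refine ⟨fun j => ?_, hm.1, Int.emod_eq_zero_of_dvd hm.2⟩
        have := abs_lt.mp (hcon j)
        rw [mem_Icc]; omega
      obtain ⟨j, hj⟩ := hj
      have hjU : j ∈ univ.filter (fun j => m j ≠ 0) := by
        simp only [mem_filter, mem_univ, true_and]
        intro h; rw [h] at hj; simp at hj; omega
      have hU : univ.filter (fun j => m j ≠ 0) ∈
          (univ : Finset (Finset (Fin s))).filter (· ≠ ∅) := by
        rw [mem_filter]
        exact ⟨mem_univ _, Finset.nonempty_iff_ne_empty.mp ⟨j, hjU⟩⟩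
      refine le_trans ?_ (Finset.single_le_sum (fun _ _ => zero_le) hU)
      rw [aux_r α γ hγ m]
      refine mul_le_mul' le_rfl ?_
      refine le_trans ?_ (Finset.single_le_sum (fun _ _ => zero_le) hjU)
      rw [if_pos ⟨hm.2, hj⟩]
    all_goals exact zero_le
  refine (ENNReal.tsum_le_tsum h1).trans ?_
  rw [ENNReal.tsum_add]
  apply add_le_add
  · rw [Tsum, ENNReal.ofReal_sum_of_nonneg (fun m _ => hr m), ← hB, tsum_eq_sum (s := B)]
    · apply le_of_eq
      apply Finset.sum_congr rfl
      intro m hm; rw [if_pos hm]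
    · intro m hm; rw [if_neg hm]
  · rw [Summable.tsum_finsetSum (fun _ _ => ENNReal.summable)]
    have hζ := aux_zeta_nonneg α hα
    have h2 : ENNReal.ofReal (auxR γ N s α) =
        ∑ u ∈ (Finset.Icc 1 s).powerset.filter (· ≠ ∅), ENNReal.ofReal (γ u) *
          (ENNReal.ofReal ((N:ℝ) ^ (-α)) *
          (ENNReal.ofReal (4 * (riemannZeta (α : ℂ)).re)) ^ u.card) := by
      rw [auxR, ENNReal.ofReal_mul (by positivity), ENNReal.ofReal_sum_of_nonneg, Finset.mul_sum]
      · apply Finset.sum_congr rfl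
        intro u _
        rw [ENNReal.ofReal_mul (hγ u).le, ENNReal.ofReal_pow (by positivity), one_div,
          Real.rpow_neg (by positivity)]
        ring
      · intro u _
        have := hγ u
        positivity
    rw [h2, ← aux_powerset]
    apply Finset.sum_le_sum
    intro U _
    rw [ENNReal.tsum_mul_left, Summable.tsum_finsetSum (fun _ _ => ENNReal.summable)]
    refine mul_le_mul' le_rfl ?_
    refine (Finset.sum_le_sum fun j hj => aux_B α hα N hN z hgcd U j hj).trans ?_
    have hinj : Function.Injective (fun j : Fin s => (j:ℕ)+1) := by
      intro a b h; simp at h; exact Fin.ext h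
    have e4 : ENNReal.ofReal (4 * (riemannZeta (α : ℂ)).re) =
        ENNReal.ofReal 2 * ENNReal.ofReal (2 * (riemannZeta (α : ℂ)).re) := by
      rw [← ENNReal.ofReal_mul (by norm_num)]; congr 1; ring
    rw [Finset.sum_const, aux_W α hα, Finset.card_image_of_injective _ hinj, nsmul_eq_mul,
      e4, mul_pow, mul_left_comm]
    refine mul_le_mul' le_rfl (mul_le_mul' ?_ le_rfl)
    rw [show ENNReal.ofReal 2 = ((2:ℕ):ℝ≥0∞) by simp]
    exact_mod_cast (Nat.lt_two_pow_self (n := U.card)).le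

lemma aux_charsum (N : ℕ) (hN : 1 ≤ N) (a : ℤ) :
    (N:ℂ)⁻¹ * ∑ k ∈ Finset.range N, Complex.exp ((2 * (Real.pi : ℂ) * Complex.I) * (k * a / N)) =
      if (N:ℤ) ∣ a then 1 else 0 := by
  have hN0 : (N:ℂ) ≠ 0 := by exact_mod_cast (by omega : N ≠ 0)
  set ω := Complex.exp ((2 * (Real.pi : ℂ) * Complex.I) * (a / N)) with hω
  have h1 : ∀ k : ℕ, Complex.exp ((2 * (Real.pi : ℂ) * Complex.I) * (k * a / N)) = ω ^ k := by
    intro k; rw [hω, ← Complex.exp_nat_mul]; congr 1; ring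
  simp_rw [h1]
  have hone : ω = 1 ↔ (N:ℤ) ∣ a := by
    rw [hω, Complex.exp_eq_one_iff]
    have hpi : (2 * (Real.pi : ℂ) * Complex.I) ≠ 0 := Complex.two_pi_I_ne_zero
    constructor
    · rintro ⟨n, hn⟩
      refine ⟨n, ?_⟩
      rw [mul_comm (n:ℂ)] at hn
      have := mul_left_cancel₀ hpi hn
      rw [div_eq_iff hN0] at this
      have : a = n * N := by exact_mod_cast this
      rw [this]; ring
    · rintro ⟨n, rfl⟩
      refine ⟨n, ?_⟩
      push_cast
      field_simp
  split_ifs with h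
  · rw [hone.mpr h]; simp [hN0]
  · have hne : ω ≠ 1 := fun h' => h (hone.mp h')
    have hpow : ω ^ N = 1 := by
      rw [hω, ← Complex.exp_nat_mul, Complex.exp_eq_one_iff]
      exact ⟨a, by field_simp⟩
    rw [geom_sum_eq hne, hpow]; simp

lemma aux_fract (N s : ℕ) (z : ℕ → ℤ) (k : ℕ) (m : Fin s → ℤ) :
    Complex.exp ((2 * (Real.pi : ℂ) * Complex.I) * ∑ j, (m j : ℂ) *
      ((Int.fract ((k : ℝ) * (z ((j : ℕ) + 1) : ℝ) / (N : ℝ)) : ℝ) : ℂ)) =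
    Complex.exp ((2 * (Real.pi : ℂ) * Complex.I) *
      (k * (∑ j, m j * z ((j:ℕ)+1) : ℤ) / N)) := by
  rw [Complex.exp_eq_exp_iff_exists_int]
  refine ⟨-∑ j, m j * ⌊(k : ℝ) * (z ((j : ℕ) + 1) : ℝ) / (N : ℝ)⌋, ?_⟩
  have : ∑ j, (m j : ℂ) * ((Int.fract ((k : ℝ) * (z ((j : ℕ) + 1) : ℝ) / (N : ℝ)) : ℝ) : ℂ) =
    k * (∑ j, m j * z ((j:ℕ)+1) : ℤ) / N +
      ((-∑ j, m j * ⌊(k : ℝ) * (z ((j : ℕ) + 1) : ℝ) / (N : ℝ)⌋ : ℤ) : ℂ) := by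
    push_cast
    rw [Finset.mul_sum, Finset.sum_div, ← Finset.sum_neg_distrib, ← Finset.sum_add_distrib]
    apply Finset.sum_congr rfl
    intro j _
    rw [Int.fract]
    push_cast
    ring
  rw [this]
  ring

lemma aux_summable (γ : Finset ℕ → ℝ) (hγ : ∀ u, 0 < γ u) (s : ℕ) (α : ℝ) (hα : 1 < α)
    (f : (Fin s → ℝ) → ℂ) (hf : ∀ m, ‖fcoeff s f m‖ ≤ 1 / rweight α γ m) :
    Summable (fun m => ‖fcoeff s f m‖) := by
  classical
  have h := aux_E γ hγ 1 s le_rfl (fun _ => 1) (by simp) α hα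
  have h1 : ∀ m, ENNReal.ofReal ‖fcoeff s f m‖ ≤
      (if m ≠ 0 ∧ ((1:ℕ) : ℤ) ∣ ∑ i, m i * 1 then ENNReal.ofReal (1 / rweight α γ m) else 0) +
      (if m = 0 then ENNReal.ofReal (1 / rweight α γ (0 : Fin s → ℤ)) else 0) := by
    intro m
    by_cases hm : m = 0
    · subst hm; simpa using ENNReal.ofReal_le_ofReal (hf 0)
    · simpa [hm] using ENNReal.ofReal_le_ofReal (hf m)
  have h2 := ENNReal.tsum_le_tsum h1
  rw [ENNReal.tsum_add, tsum_ite_eq] at h2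
  have h3 : ∑' m, ENNReal.ofReal ‖fcoeff s f m‖ ≠ ⊤ := by
    refine ne_top_of_le_ne_top ?_ (h2.trans (add_le_add_left h _))
    simp
  have := ENNReal.summable_toReal h3
  simpa using this

lemma aux_main (γ : Finset ℕ → ℝ) (hγpos : ∀ u, 0 < γ u)
    (N s : ℕ) (hN : 1 ≤ N) (z : ℕ → ℤ)
    (hgcd : ∀ j ∈ Finset.Icc 1 s, Int.gcd (z j) (N : ℤ) = 1)
    (α : ℝ) (hα : 1 < α) (f : (Fin s → ℝ) → ℂ) (hc : Continuous f)
    (hf : ∀ m : Fin s → ℤ, ‖fcoeff s f m‖ * rweight α γ m ≤ 1) (hT : 0 ≤ Tsum α γ N s z)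
    (hR : 0 ≤ auxR γ N s α) :
    ‖(∫ x in cube s, f x) - qmc N s z f‖ ≤ Tsum α γ N s z + auxR γ N s α := by
  classical
  have hrpos : ∀ m : Fin s → ℤ, 0 < rweight α γ m := by
    intro m
    rw [rweight]
    apply mul_pos (inv_pos.mpr (hγpos _))
    apply Finset.prod_pos
    intro i hi
    simp only [mem_filter, mem_univ, true_and] at hi
    exact Real.rpow_pos_of_pos (abs_pos.mpr (by exact_mod_cast hi)) _
  have hf' : ∀ m, ‖fcoeff s f m‖ ≤ 1 / rweight α γ m := fun m =>
    (le_div_iff₀ (hrpos m)).mpr (hf m)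
  have hsum := aux_summable γ hγpos s α hα f hf'
  have hq : HasSum (fun m : Fin s → ℤ => if (N:ℤ) ∣ ∑ i : Fin s, m i * z ((i:ℕ)+1) then fcoeff s f m else 0)
      (qmc N s z f) := by
    have h1 := (hasSum_sum (s := Finset.range N) (fun k _ => aux_fourier f hc hsum
      (fun j => Int.fract ((k : ℝ) * (z ((j : ℕ) + 1) : ℝ) / (N : ℝ)))
      (fun j _ => ⟨Int.fract_nonneg _, (Int.fract_lt_one _).le⟩))).mul_left ((N:ℂ)⁻¹)
    rw [qmc]
    refine h1.congr_fun ?_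
    intro m
    simp only [aux_fract]
    rw [← Finset.mul_sum, mul_left_comm, aux_charsum N hN]
    simp
  have h0 : ∫ x in cube s, f x = fcoeff s f 0 := by simp [fcoeff]
  have hd : HasSum (fun m : Fin s → ℤ => if m ≠ 0 ∧ (N:ℤ) ∣ ∑ i : Fin s, m i * z ((i:ℕ)+1) then -fcoeff s f m else 0)
      ((∫ x in cube s, f x) - qmc N s z f) := by
    rw [h0]
    refine ((hasSum_ite_eq (0 : Fin s → ℤ) (fcoeff s f 0)).sub hq).congr_fun ?_
    intro m
    by_cases hm : m = 0
    · subst hm; simp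
    · by_cases hd : (N:ℤ) ∣ ∑ i : Fin s, m i * z ((i:ℕ)+1) <;> simp [hm, hd]
  rw [← ENNReal.ofReal_le_ofReal_iff (by positivity), ENNReal.ofReal_add hT hR,
    ofReal_norm, ← hd.tsum_eq]
  refine enorm_tsum_le_tsum_enorm.trans (le_trans ?_ (aux_E γ hγpos N s hN z hgcd α hα))
  apply ENNReal.tsum_le_tsum
  intro m
  split_ifs
  · rw [enorm_neg, ← ofReal_norm]
    exact ENNReal.ofReal_le_ofReal (hf' m)
  · simp


end AuxLemmas

/-- Proposition 1: for strictly positive weights `γ`, a generating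
vector `z` with `gcd(z_j, N) = 1` for all `j ∈ {1,…,s}`, and `α > 1`,
`e_{N,s,α,γ}(z) - T_{α,γ}(N,z) ≤ N^{-α} ∑_{∅≠u⊆{1:s}} γ_u (4ζ(α))^{|u|}`. -/
theorem statement0 (γ : Finset ℕ → ℝ) (hγpos : ∀ u, 0 < γ u) (hγempty : γ ∅ = 1)
    (N s : ℕ) (hN : 1 ≤ N) (hs : 1 ≤ s) (z : ℕ → ℤ)
    (hgcd : ∀ j ∈ Finset.Icc 1 s, Int.gcd (z j) (N : ℤ) = 1)
    (α : ℝ) (hα : 1 < α) :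
    wce N s α γ z - Tsum α γ N s z ≤
      (1 / (N : ℝ) ^ α) *
        ∑ u ∈ (Finset.Icc 1 s).powerset.filter (· ≠ ∅),
          γ u * (4 * (riemannZeta (α : ℂ)).re) ^ u.card := by
  classical
  have hT : 0 ≤ Tsum α γ N s z := by
    rw [Tsum]
    apply Finset.sum_nonneg
    intro m _
    rw [rweight]
    have := hγpos (msupp m)
    positivity
  have hR : 0 ≤ auxR γ N s α := by
    have hζ := aux_zeta_nonneg α hα
    rw [auxR]
    apply mul_nonneg (by positivity)
    apply Finset.sum_nonneg
    intro u _
    have := hγpos u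
    positivity
  change _ ≤ auxR γ N s α
  rw [sub_le_iff_le_add', wce]
  refine Real.iSup_le (fun f => Real.iSup_le (fun hf => ?_) (by positivity)) (by positivity)
  exact aux_main γ hγpos N s hN z hgcd α hα f hf.1 hf.2 hT hR

end
end

section
/- Let n, s ∈ ℕ, N = 2^n, and let γ = {γ_u} be strictly positive weights with γ_∅ = 1. If the generating vector z = (z_1,…,z_s) ∈ ℤ_N^s is constructed by the CBC-DBD algorithm, then H_{s,n,γ}(z) ≤ H_{s−1,n,γ}(z_{{1:s−1}}) + (log 4)·[γ_{{s}} N + H_{s−1,n,γ∪{s}}(z_{{1:s−1}})], where z_{{1:s−1}} = (z_1,…,z_{s−1}). -/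
open Finset MeasureTheory

noncomputable section

theorem lsin_nonneg' (a : ℝ) : 0 ≤ lsin a := by
  unfold lsin
  rw [one_div, Real.log_inv]
  have := Real.log_nonpos (sq_nonneg (Real.sin (Real.pi * a))) (Real.sin_sq_le_one _)
  linarith

theorem lsin_add_int (a : ℝ) (m : ℤ) : lsin (a + m) = lsin a := by
  unfold lsin
  rw [show Real.pi * (a + m) = Real.pi * a + m * Real.pi by ring, Real.sin_add_int_mul_pi,
    mul_pow, ← zpow_natCast, ← zpow_mul, mul_comm m, zpow_mul]
  simp

theorem lsin_half (m : ℤ) : lsin ((m : ℝ) + 1 / 2) = 0 := by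
  rw [add_comm, lsin_add_int]
  unfold lsin
  rw [show Real.pi * (1 / 2) = Real.pi / 2 by ring]
  simp

theorem lsin_double (a : ℝ) (h : Real.sin (2 * (Real.pi * a)) ≠ 0) :
    lsin a + lsin (a + 1 / 2) = Real.log 4 + lsin (2 * a) := by
  have h2 := Real.sin_two_mul (Real.pi * a)
  have hs : Real.sin (Real.pi * a) ≠ 0 := by
    intro h0; rw [h0] at h2; simp at h2; exact h h2
  have hc : Real.cos (Real.pi * a) ≠ 0 := by
    intro h0; rw [h0] at h2; simp at h2; exact h h2
  unfold lsin
  rw [show Real.pi * (a + 1 / 2) = Real.pi * a + Real.pi / 2 by ring, Real.sin_add_pi_div_two,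
    show Real.pi * (2 * a) = 2 * (Real.pi * a) by ring, ← Real.log_mul (by positivity) (by positivity),
    ← Real.log_mul (by positivity) (by positivity), h2]
  congr 1
  field_simp
  norm_num

theorem sin_ne (m : ℤ) (v : ℕ) (hv : 1 ≤ v) (hm : Odd m) :
    Real.sin (Real.pi * ((m : ℝ) / 2 ^ v)) ≠ 0 := by
  intro h
  rw [Real.sin_eq_zero_iff] at h
  obtain ⟨j, hj⟩ := h
  have : (j : ℝ) * 2 ^ v = m := by
    have hp := Real.pi_pos.ne'
    field_simp at hj
    linarith
  have h2 : j * 2 ^ v = m := by exact_mod_cast this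
  have : (2 : ℤ) ∣ m := by
    rw [← h2]; exact Dvd.dvd.mul_left (dvd_pow_self 2 (by omega)) _
  rw [← Int.not_even_iff_odd] at hm
  exact hm (even_iff_two_dvd.mpr this)

def oddS (t : ℕ) : Finset ℕ := (Finset.Icc (1:ℕ) (2 ^ t - 1)).filter (fun k => Odd k)

theorem group_sum (n : ℕ) (g : ℝ → ℝ) :
    ∑ k ∈ Finset.Icc (1:ℕ) (2 ^ n - 1), g ((k : ℝ) / 2 ^ n) =
      ∑ t ∈ Finset.Icc 1 n, ∑ k ∈ oddS t, g ((k : ℝ) / 2 ^ t) := by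
  induction n with
  | zero => simp
  | succ n ih =>
    rw [Finset.sum_Icc_succ_top (by omega), ← ih,
      ← Finset.sum_filter_add_sum_filter_not (Finset.Icc (1:ℕ) (2 ^ (n+1) - 1)) (fun k => Odd k), add_comm]
    congr 1
    symm
    apply Finset.sum_bij (fun k _ => 2 * k)
    · intro k hk
      simp only [Finset.mem_filter, Finset.mem_Icc] at hk ⊢
      refine ⟨⟨by omega, by rw [pow_succ]; omega⟩, by simp⟩
    · intro a _ b _ h; simpa using h
    · intro b hb
      simp only [Finset.mem_filter, Finset.mem_Icc, Nat.not_odd_iff_even] at hb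
      obtain ⟨⟨h1, h2⟩, c, hc⟩ := hb
      rw [pow_succ] at h2
      exact ⟨c, by simp only [Finset.mem_Icc]; omega, by omega⟩
    · intro k _
      congr 1
      push_cast
      rw [pow_succ]; field_simp

def Gs (F : ℕ → ℕ → ℝ) (n v : ℕ) (x : ℤ) : ℝ :=
  ∑ t ∈ Finset.Icc v n, (1 / 2 ^ (t - v) : ℝ) *
    ∑ k ∈ oddS t, lsin ((k : ℝ) * (x : ℝ) / 2 ^ v) * F t k

theorem core (n : ℕ) (hn : 1 ≤ n) (F : ℕ → ℕ → ℝ) (hF : ∀ t k, 0 ≤ F t k) (y : ℕ → ℤ)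
    (hy1 : y 1 = 1)
    (hy : ∀ v, 1 ≤ v → v + 1 ≤ n → ∃ zs : ℤ, y (v + 1) = y v + zs * 2 ^ v ∧
      Gs F n (v + 1) (y (v + 1)) ≤ Gs F n (v + 1) (y v) ∧
      Gs F n (v + 1) (y (v + 1)) ≤ Gs F n (v + 1) (y v + 2 ^ v)) :
    ∑ t ∈ Finset.Icc 1 n, ∑ k ∈ oddS t, lsin ((k : ℝ) * (y n : ℝ) / 2 ^ t) * F t k ≤
      Real.log 4 * ∑ t ∈ Finset.Icc 1 n, ∑ k ∈ oddS t, F t k := by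
  have hlog : 0 ≤ Real.log 4 := Real.log_nonneg (by norm_num)
  have hodd : ∀ v, 1 ≤ v → v ≤ n → Odd (y v) := by
    intro v hv
    induction v, hv using Nat.le_induction with
    | base => intro _; rw [hy1]; exact odd_one
    | succ v hv ih =>
      intro h
      obtain ⟨zs, h1, -⟩ := hy v hv h
      rw [h1]
      refine (ih (by omega)).add_even (Even.mul_left ?_ _)
      exact (Int.even_pow.mpr ⟨even_two, by omega⟩)
  have hcong : ∀ t, 1 ≤ t → ∀ m, t ≤ m → m ≤ n → ∃ c : ℤ, y m = y t + c * 2 ^ t := by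
    intro t ht m hm
    induction m, hm using Nat.le_induction with
    | base => intro _; exact ⟨0, by simp⟩
    | succ m hm ih =>
      intro h
      obtain ⟨c, hc⟩ := ih (by omega)
      obtain ⟨zs, h1, -⟩ := hy m (by omega) h
      obtain ⟨d, rfl⟩ := Nat.exists_eq_add_of_le hm
      exact ⟨c + zs * 2 ^ d, by rw [h1, hc, pow_add]; ring⟩
  set A : ℕ → ℝ := fun t => ∑ k ∈ oddS t, F t k with hA
  set B : ℕ → ℝ := fun t => ∑ k ∈ oddS t, lsin ((k : ℝ) * (y n : ℝ) / 2 ^ t) * F t k with hB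
  have hA0 : ∀ t, 0 ≤ A t := fun t => Finset.sum_nonneg fun k _ => hF t k
  have hBt : ∀ t, 1 ≤ t → t ≤ n →
      B t = ∑ k ∈ oddS t, lsin ((k : ℝ) * (y t : ℝ) / 2 ^ t) * F t k := by
    intro t ht htn
    obtain ⟨c, hc⟩ := hcong t ht n htn le_rfl
    apply Finset.sum_congr rfl
    intro k _
    congr 1
    rw [hc, ← lsin_add_int ((k : ℝ) * (y t : ℝ) / 2 ^ t) (k * c)]
    congr 1
    push_cast
    field_simp
  set D : ℕ → ℝ := fun v => ∑ t ∈ Finset.Icc v n, (1 / 2 ^ (t - v) : ℝ) * A t with hD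
  have peel : ∀ (f : ℕ → ℝ) v, v + 1 ≤ n → ∑ t ∈ Finset.Icc v n, (1 / 2 ^ (t - v) : ℝ) * f t =
      f v + (1 / 2) * ∑ t ∈ Finset.Icc (v + 1) n, (1 / 2 ^ (t - (v + 1)) : ℝ) * f t := by
    intro f v hv
    rw [← Finset.add_sum_Ioc_eq_sum_Icc (by omega : v ≤ n), Finset.mul_sum,
      ← Finset.Icc_add_one_left_eq_Ioc]
    congr 1
    · simp
    · apply Finset.sum_congr rfl
      intro t ht
      simp only [Finset.mem_Icc] at ht
      rw [show t - v = (t - (v + 1)) + 1 by omega, pow_succ]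
      field_simp
  have main : ∀ v, 1 ≤ v → v ≤ n → ∑ t ∈ Finset.Ico 1 v, B t + Gs F n v (y v) ≤
      Real.log 4 * (∑ t ∈ Finset.Ico 1 v, A t + D v) := by
    intro v hv
    induction v, hv using Nat.le_induction with
    | base =>
      intro _
      have h0 : Gs F n 1 (y 1) = 0 := by
        apply Finset.sum_eq_zero
        intro t _
        rw [mul_eq_zero]; right
        apply Finset.sum_eq_zero
        intro k hk
        simp only [oddS, Finset.mem_filter] at hk
        obtain ⟨-, c, hc⟩ := hk
        have := lsin_half c
        rw [hy1, hc, show (((2 * c + 1 : ℕ) : ℝ) * ((1 : ℤ) : ℝ) / 2 ^ 1) = ((c : ℤ) : ℝ) + 1 / 2 by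
          push_cast; ring, this, zero_mul]
      rw [h0]
      simp only [Finset.Ico_self, Finset.sum_empty, zero_add]
      exact mul_nonneg hlog (Finset.sum_nonneg fun t _ => mul_nonneg (by positivity) (hA0 t))
    | succ v hv ih =>
      intro h
      have ih := ih (by omega)
      obtain ⟨zs, h1, h2, h3⟩ := hy v hv h
      have hG : Gs F n v (y v) = B v + (1 / 2) * ∑ t ∈ Finset.Icc (v + 1) n,
          (1 / 2 ^ (t - (v + 1)) : ℝ) * ∑ k ∈ oddS t, lsin ((k : ℝ) * (y v : ℝ) / 2 ^ v) * F t k := by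
        rw [hBt v hv (by omega)]
        exact peel (fun t => ∑ k ∈ oddS t, lsin ((k : ℝ) * (y v : ℝ) / 2 ^ v) * F t k) v h
      have hDv : D v = A v + (1 / 2) * D (v + 1) := peel A v h
      have havg : Gs F n (v + 1) (y v) + Gs F n (v + 1) (y v + 2 ^ v) =
          Real.log 4 * D (v + 1) + ∑ t ∈ Finset.Icc (v + 1) n,
          (1 / 2 ^ (t - (v + 1)) : ℝ) * ∑ k ∈ oddS t, lsin ((k : ℝ) * (y v : ℝ) / 2 ^ v) * F t k := by
        simp only [hD, hA, Gs]
        rw [Finset.mul_sum, ← Finset.sum_add_distrib, ← Finset.sum_add_distrib]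
        apply Finset.sum_congr rfl
        intro t _
        rw [mul_left_comm, ← mul_add, ← mul_add, Finset.mul_sum, ← Finset.sum_add_distrib,
          ← Finset.sum_add_distrib]
        congr 1
        apply Finset.sum_congr rfl
        intro k hk
        simp only [oddS, Finset.mem_filter] at hk
        obtain ⟨-, hk⟩ := hk
        rw [← add_mul, ← add_mul]
        congr 1
        have hs := sin_ne (k * y v) v hv (Odd.mul (by exact_mod_cast hk) (hodd v hv (by omega)))
        have e1 : 2 * ((k : ℝ) * (y v : ℝ) / 2 ^ (v + 1)) = (k : ℝ) * (y v : ℝ) / 2 ^ v := by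
          rw [pow_succ]; field_simp
        have := lsin_double ((k : ℝ) * (y v : ℝ) / 2 ^ (v + 1)) (by
          rw [show 2 * (Real.pi * ((k : ℝ) * (y v : ℝ) / 2 ^ (v + 1))) =
            Real.pi * (2 * ((k : ℝ) * (y v : ℝ) / 2 ^ (v + 1))) by ring, e1]
          push_cast at hs
          exact hs)
        rw [e1] at this
        rw [← this]
        congr 1
        obtain ⟨c, hc⟩ := hk
        rw [← lsin_add_int ((k : ℝ) * (y v : ℝ) / 2 ^ (v + 1) + 1 / 2) c]
        congr 1
        rw [hc]
        push_cast
        rw [pow_succ]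
        field_simp
        ring
      rw [Finset.sum_Ico_succ_top hv, Finset.sum_Ico_succ_top hv]
      rw [hG, hDv] at ih
      linarith
  have hfin := main n hn le_rfl
  have hGn : Gs F n n (y n) = B n := by simp [Gs, hB]
  have hDn : D n = A n := by simp [hD]
  rw [hGn, hDn, ← Finset.sum_Ico_succ_top hn, ← Finset.sum_Ico_succ_top hn] at hfin
  exact hfin

theorem P_le (n : ℕ) :
    ∑ k ∈ Finset.Icc (1:ℕ) (2 ^ n - 1), lsin ((k : ℝ) / 2 ^ n) ≤ Real.log 4 * (2 ^ n - 1) := by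
  have hlog : 0 ≤ Real.log 4 := Real.log_nonneg (by norm_num)
  have hIcc : ∀ m : ℕ, Finset.Icc (1:ℕ) (2 ^ m - 1) = Finset.Ico 1 (2 ^ m) := by
    intro m; ext k
    have : 0 < 2 ^ m := by positivity
    simp only [Finset.mem_Icc, Finset.mem_Ico]; omega
  simp only [hIcc]
  induction n with
  | zero => simp
  | succ n ih =>
    have hp : 1 ≤ 2 ^ n := Nat.one_le_two_pow
    rw [← Finset.sum_Ico_consecutive _ hp (by rw [pow_succ]; omega : 2 ^ n ≤ 2 ^ (n + 1)),
      show Finset.Ico (2 ^ n) (2 ^ (n+1)) = Finset.Ico (0 + 2 ^ n) (2 ^ n + 2 ^ n) by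
        rw [pow_succ, mul_two, zero_add],
      ← Finset.sum_Ico_add' (fun k : ℕ => lsin ((k : ℝ) / 2 ^ (n+1))), Finset.sum_eq_sum_Ico_succ_bot (by omega : 0 < 2 ^ n)]
    have h0 : lsin (((0 + 2 ^ n : ℕ) : ℝ) / 2 ^ (n + 1)) = 0 := by
      rw [← lsin_half 0]; congr 1; push_cast; rw [pow_succ]; field_simp; ring
    rw [h0, zero_add, zero_add, ← Finset.sum_add_distrib]
    have : ∀ k ∈ Finset.Ico (1:ℕ) (2 ^ n), lsin ((k : ℝ) / 2 ^ (n + 1)) +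
        lsin (((k + 2 ^ n : ℕ) : ℝ) / 2 ^ (n + 1)) = Real.log 4 + lsin ((k : ℝ) / 2 ^ n) := by
      intro k hk
      simp only [Finset.mem_Ico] at hk
      have e : (k : ℝ) / 2 ^ n = 2 * ((k : ℝ) / 2 ^ (n + 1)) := by rw [pow_succ]; field_simp
      rw [e, ← lsin_double]
      · congr 2; push_cast; rw [pow_succ]; field_simp
      · rw [show 2 * (Real.pi * ((k : ℝ) / 2 ^ (n + 1))) =
            Real.pi * (2 * ((k : ℝ) / 2 ^ (n + 1))) by ring, ← e]
        have hk1 : (1 : ℝ) ≤ k := by exact_mod_cast hk.1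
        have hk2 : (k : ℝ) < 2 ^ n := by exact_mod_cast hk.2
        refine (Real.sin_pos_of_pos_of_lt_pi (by positivity) ?_).ne'
        have : (k : ℝ) / 2 ^ n < 1 := by rw [div_lt_one (by positivity)]; exact hk2
        nlinarith [Real.pi_pos]
    rw [Finset.sum_congr rfl this, Finset.sum_add_distrib]
    simp only [Finset.sum_const, Nat.card_Ico, nsmul_eq_mul]
    rw [Nat.cast_sub hp]
    push_cast
    rw [pow_succ]
    nlinarith

theorem pow_split (s : ℕ) (f : Finset ℕ → ℝ) :
    ∑ u ∈ (Finset.Icc 1 s).powerset, f u =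
      f ∅ + ∑ u ∈ (Finset.Icc 1 s).powerset.filter (· ≠ ∅), f u := by
  rw [Finset.filter_ne', Finset.add_sum_erase _ _ (Finset.empty_mem_powerset _)]

theorem inner_split (s : ℕ) (hs : 1 ≤ s) (γ : Finset ℕ → ℝ) (c : ℕ → ℝ) :
    ∑ u ∈ (Finset.Icc 1 s).powerset.filter (· ≠ ∅), γ u * ∏ j ∈ u, c j =
      ∑ u ∈ (Finset.Icc 1 (s - 1)).powerset.filter (· ≠ ∅), γ u * ∏ j ∈ u, c j +
        c s * ∑ u ∈ (Finset.Icc 1 (s - 1)).powerset, γ (u ∪ {s}) * ∏ j ∈ u, c j := by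
  have h1 := pow_split s (fun u => γ u * ∏ j ∈ u, c j)
  have h2 := pow_split (s - 1) (fun u => γ u * ∏ j ∈ u, c j)
  have hI : Finset.Icc 1 s = insert s (Finset.Icc 1 (s - 1)) := by
    ext k; simp only [Finset.mem_Icc, Finset.mem_insert]; omega
  have hns : s ∉ Finset.Icc 1 (s - 1) := by simp only [Finset.mem_Icc]; omega
  rw [hI, Finset.sum_powerset_insert hns, ← hI] at h1
  have h3 : ∑ u ∈ (Finset.Icc 1 (s - 1)).powerset, γ (insert s u) * ∏ j ∈ insert s u, c j =
      c s * ∑ u ∈ (Finset.Icc 1 (s - 1)).powerset, γ (u ∪ {s}) * ∏ j ∈ u, c j := by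
    rw [Finset.mul_sum]
    apply Finset.sum_congr rfl
    intro u hu
    have : s ∉ u := fun h => hns (Finset.mem_powerset.mp hu h)
    rw [Finset.prod_insert this, Finset.union_comm, ← Finset.insert_eq]
    ring
  rw [h3] at h1
  linarith

def Ff (γ : Finset ℕ → ℝ) (s : ℕ) (z : ℕ → ℤ) (a : ℝ) : ℝ :=
  ∑ u ∈ (Finset.Icc 1 (s - 1)).powerset, γ (u ∪ {s}) * ∏ j ∈ u, lsin (a * (z j : ℝ))

theorem Ff_eq (γ : Finset ℕ → ℝ) (s : ℕ) (z : ℕ → ℤ) (k t : ℕ) :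
    ∑ u ∈ (Finset.Icc 1 (s - 1)).powerset, γ (u ∪ {s}) * ∏ j ∈ u, lsin ((k : ℝ) * (z j : ℝ) / 2 ^ t)
      = Ff γ s z ((k : ℝ) / 2 ^ t) := by
  unfold Ff
  simp only [mul_div_right_comm]

theorem Hsum_split (n s : ℕ) (hs : 1 ≤ s) (γ : Finset ℕ → ℝ) (z : ℕ → ℤ) :
    Hsum γ s n z = Hsum γ (s - 1) n z +
      ∑ k ∈ Finset.Icc (1:ℕ) (2 ^ n - 1), lsin ((k : ℝ) * (z s : ℝ) / 2 ^ n) * Ff γ s z ((k : ℝ) / 2 ^ n) := by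
  unfold Hsum
  rw [← Finset.sum_add_distrib]
  apply Finset.sum_congr rfl
  intro k _
  rw [inner_split s hs γ (fun j => lsin ((k : ℝ) * (z j : ℝ) / 2 ^ n)), Ff_eq]

theorem Hsum_union (n s : ℕ) (γ : Finset ℕ → ℝ) (z : ℕ → ℤ) :
    γ {s} * 2 ^ n + Hsum (unionWeights γ {s}) (s - 1) n z =
      γ {s} + ∑ k ∈ Finset.Icc (1:ℕ) (2 ^ n - 1), Ff γ s z ((k : ℝ) / 2 ^ n) := by
  have : ∀ k ∈ Finset.Icc (1:ℕ) (2 ^ n - 1), Ff γ s z ((k : ℝ) / 2 ^ n) =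
      γ {s} + ∑ u ∈ (Finset.Icc 1 (s - 1)).powerset.filter (· ≠ ∅),
        unionWeights γ {s} u * ∏ j ∈ u, lsin ((k : ℝ) * (z j : ℝ) / 2 ^ n) := by
    intro k _
    rw [← Ff_eq, pow_split]
    simp [unionWeights]
  rw [Finset.sum_congr rfl this, Finset.sum_add_distrib]
  unfold Hsum
  simp only [Finset.sum_const, Nat.card_Icc, nsmul_eq_mul]
  rw [Nat.add_sub_cancel, Nat.cast_sub Nat.one_le_two_pow]
  push_cast
  ring

theorem hqual_eq (γ : Finset ℕ → ℝ) (n v r : ℕ) (z : ℕ → ℤ) : ∃ C : ℝ, ∀ x : ℤ,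
    hqual γ n v r z x = C + Gs (fun t k => Ff γ r z ((k : ℝ) / 2 ^ t)) n v x := by
  refine ⟨∑ t ∈ Finset.Icc v n, (1 / 2 ^ (t - v) : ℝ) *
    ∑ k ∈ oddS t, ∑ u ∈ (Finset.Icc 1 (r - 1)).powerset.filter (· ≠ ∅),
          γ u * ∏ j ∈ u, lsin ((k : ℝ) * (z j : ℝ) / 2 ^ t), fun x => ?_⟩
  unfold hqual Gs
  rw [← Finset.sum_add_distrib]
  apply Finset.sum_congr rfl
  intro t _
  rw [← mul_add, ← Finset.sum_add_distrib]
  congr 1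
  apply Finset.sum_congr rfl
  intro k _
  beta_reduce
  rw [← Ff_eq, Finset.mul_sum]
  congr 1
  apply Finset.sum_congr rfl
  intro u _
  ring

/-- Theorem 3: if `z ∈ ℤ_N^s`, `N = 2^n`, is constructed by the
CBC-DBD algorithm for strictly positive weights `γ` with `γ_∅ = 1`, then
`H_{s,n,γ}(z) ≤ H_{s-1,n,γ}(z_{1:s-1}) + (log 4)[γ_{{s}} N + H_{s-1,n,γ∪{s}}(z_{1:s-1})]`. -/
theorem statement2 (n s : ℕ) (hn : 1 ≤ n) (hs : 1 ≤ s)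
    (γ : Finset ℕ → ℝ) (hγpos : ∀ u, 0 < γ u) (hγempty : γ ∅ = 1)
    (z : ℕ → ℤ) (hz : IsCBCDBD γ n s z) :
    Hsum γ s n z ≤
      Hsum γ (s - 1) n z +
        Real.log 4 * (γ {s} * 2 ^ n + Hsum (unionWeights γ {s}) (s - 1) n z) := by
  have hlog : 0 ≤ Real.log 4 := Real.log_nonneg (by norm_num)
  rw [Hsum_split n s hs, Hsum_union]
  have hγs := mul_nonneg hlog (hγpos {s}).le
  have key : ∑ k ∈ Finset.Icc (1:ℕ) (2 ^ n - 1),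
      lsin ((k : ℝ) * (z s : ℝ) / 2 ^ n) * Ff γ s z ((k : ℝ) / 2 ^ n) ≤
      Real.log 4 * ∑ k ∈ Finset.Icc (1:ℕ) (2 ^ n - 1), Ff γ s z ((k : ℝ) / 2 ^ n) := by
    obtain ⟨hz1, zz, hzz⟩ := hz
    rcases Nat.eq_or_lt_of_le hs with rfl | hs2
    · have hF : ∀ a, Ff γ 1 z a = γ {1} := by intro a; simp [Ff]
      simp only [hF, hz1]
      rw [← Finset.sum_mul]
      have h := mul_le_mul_of_nonneg_right (P_le n) (hγpos {1}).le
      simp only [Finset.sum_const, Nat.card_Icc, nsmul_eq_mul]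
      rw [Nat.add_sub_cancel, Nat.cast_sub Nat.one_le_two_pow]
      push_cast
      simp only [mul_one]
      rw [← mul_assoc]
      exact h
    · obtain ⟨hy1, hyn, hst⟩ := hzz s (Finset.mem_Icc.mpr ⟨hs2, le_rfl⟩)
      have hc := core n hn (fun t k => Ff γ s z ((k : ℝ) / 2 ^ t))
        (fun t k => Finset.sum_nonneg fun u _ => mul_nonneg (hγpos _).le
          (Finset.prod_nonneg fun j _ => lsin_nonneg' _)) (zz s) hy1 (by
          intro v hv hvn
          obtain ⟨zs, -, he, hm⟩ := hst (v + 1) (Finset.mem_Icc.mpr ⟨by omega, hvn⟩)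
          obtain ⟨C, hC⟩ := hqual_eq γ n (v + 1) s z
          rw [Nat.add_sub_cancel] at he hm
          rw [← he] at hm
          have m0 := hm 0 (by simp)
          have m1 := hm 1 (by simp)
          simp only [hC, zero_mul, add_zero, one_mul, add_le_add_iff_left] at m0 m1
          exact ⟨zs, he, m0, m1⟩)
      rw [group_sum n (fun a => Ff γ s z a)]
      have e : ∀ t k : ℕ, lsin ((k : ℝ) * (z s : ℝ) / 2 ^ t) * Ff γ s z ((k : ℝ) / 2 ^ t) =
          (fun a => lsin (a * (z s : ℝ)) * Ff γ s z a) ((k : ℝ) / 2 ^ t) := by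
        intro t k; simp only [mul_div_right_comm]
      rw [← hyn] at hc
      simp only [e] at hc ⊢
      rw [group_sum n (fun a => lsin (a * (z s : ℝ)) * Ff γ s z a)]
      exact hc
  linarith

end
end

section
/- Let n, s ∈ ℕ with s ≥ 2, N = 2^n, let γ = {γ_u} be strictly positive weights, and let z = (z_1,…,z_s) ∈ ℤ^s. Suppose that for every r ∈ {2,…,s} and every set v ⊆ {r+1,…,s} the recursion inequality H_{r,n,γ∪v}(z_{{1:r}}) ≤ H_{r−1,n,γ∪v}(z_{{1:r−1}}) + (log 4)·[(γ∪v)_{{r}} N + H_{r−1,n,γ∪v∪{r}}(z_{{1:r−1}})] holds. Then for every m with 1 ≤ m < s, H_{s,n,γ}(z) ≤ Σ_{v⊆{m+1,…,s}} (log 4)^{|v|} H_{m,n,γ∪v}(z_{{1:m}}) + N · Σ_{∅≠v⊆{m+1,…,s}} (log 4)^{|v|} γ_v. -/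
open Finset MeasureTheory

noncomputable section

theorem aux5 (n s : ℕ)
    (γ : Finset ℕ → ℝ) (z : ℕ → ℤ)
    (hrec : ∀ r, 2 ≤ r → r ≤ s → ∀ v ∈ (Finset.Icc (r + 1) s).powerset,
      Hsum (unionWeights γ v) r n z ≤
        Hsum (unionWeights γ v) (r - 1) n z +
          Real.log 4 * (γ (insert r v) * 2 ^ n +
            Hsum (unionWeights γ (insert r v)) (r - 1) n z))
    (d : ℕ) : ∀ m, 1 ≤ m → m + d = s →
    Hsum γ s n z + 2 ^ n * γ ∅ ≤
      ∑ v ∈ (Finset.Icc (m + 1) s).powerset,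
          Real.log 4 ^ v.card * (Hsum (unionWeights γ v) m n z + 2 ^ n * γ v) := by
  induction d with
  | zero =>
    intro m _ h
    have h1 : Finset.Icc (m + 1) s = ∅ := Finset.Icc_eq_empty (by omega)
    have h2 : unionWeights γ ∅ = γ := by
      funext u
      simp [unionWeights]
    have h3 : m = s := by omega
    subst h3
    simp [h2]
  | succ d ih =>
    intro m hm h
    refine (ih (m + 1) (by omega) (by omega)).trans ?_
    have hI : Finset.Icc (m + 1) s = insert (m + 1) (Finset.Icc (m + 1 + 1) s) := by
      ext x
      simp only [Finset.mem_Icc, Finset.mem_insert]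
      omega
    have hnot : m + 1 ∉ Finset.Icc (m + 1 + 1) s := by simp
    rw [hI, Finset.sum_powerset_insert hnot, ← Finset.sum_add_distrib]
    refine Finset.sum_le_sum fun v hv => ?_
    have hr := hrec (m + 1) (by omega) (by omega) v hv
    have hv' : m + 1 ∉ v := fun hx => hnot (Finset.mem_powerset.1 hv hx)
    rw [Finset.card_insert_of_notMem hv', pow_succ]
    have hL : 0 ≤ Real.log 4 ^ v.card := pow_nonneg (Real.log_nonneg (by norm_num)) _
    simp only [Nat.add_sub_cancel] at hr
    have := mul_le_mul_of_nonneg_left hr hL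
    linarith

/-- if the recursion inequality
`H_{r,n,γ∪v}(z_{1:r}) ≤ H_{r-1,n,γ∪v}(z_{1:r-1}) + (log 4)[(γ∪v)_{{r}} N + H_{r-1,n,γ∪v∪{r}}(z_{1:r-1})]`
holds for all `r ∈ {2,…,s}` and all `v ⊆ {r+1,…,s}`, then for every `1 ≤ m < s`,
`H_{s,n,γ}(z) ≤ ∑_{v⊆{m+1:s}} (log 4)^{|v|} H_{m,n,γ∪v}(z_{1:m}) + N ∑_{∅≠v⊆{m+1:s}} (log 4)^{|v|} γ_v`. -/
theorem statement5 (n s : ℕ) (hn : 1 ≤ n) (hs : 2 ≤ s)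
    (γ : Finset ℕ → ℝ) (hγpos : ∀ u, 0 < γ u) (hγempty : γ ∅ = 1)
    (z : ℕ → ℤ)
    (hrec : ∀ r, 2 ≤ r → r ≤ s → ∀ v ∈ (Finset.Icc (r + 1) s).powerset,
      Hsum (unionWeights γ v) r n z ≤
        Hsum (unionWeights γ v) (r - 1) n z +
          Real.log 4 * (γ (insert r v) * 2 ^ n +
            Hsum (unionWeights γ (insert r v)) (r - 1) n z))
    (m : ℕ) (hm1 : 1 ≤ m) (hms : m < s) :
    Hsum γ s n z ≤
      (∑ v ∈ (Finset.Icc (m + 1) s).powerset,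
          Real.log 4 ^ v.card * Hsum (unionWeights γ v) m n z)
      + 2 ^ n * ∑ v ∈ (Finset.Icc (m + 1) s).powerset.filter (· ≠ ∅),
          Real.log 4 ^ v.card * γ v := by
  have h := aux5 n s γ z hrec (s - m) m hm1 (by omega)
  have h0 : ∑ v ∈ (Finset.Icc (m + 1) s).powerset, Real.log 4 ^ v.card * γ v
      = γ ∅ + ∑ v ∈ (Finset.Icc (m + 1) s).powerset.filter (· ≠ ∅),
          Real.log 4 ^ v.card * γ v := by
    rw [Finset.filter_ne', ← Finset.add_sum_erase _ _ (Finset.empty_mem_powerset _)]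
    simp
  have h1 : ∑ v ∈ (Finset.Icc (m + 1) s).powerset,
          Real.log 4 ^ v.card * (Hsum (unionWeights γ v) m n z + 2 ^ n * γ v)
      = (∑ v ∈ (Finset.Icc (m + 1) s).powerset,
          Real.log 4 ^ v.card * Hsum (unionWeights γ v) m n z)
        + 2 ^ n * ∑ v ∈ (Finset.Icc (m + 1) s).powerset, Real.log 4 ^ v.card * γ v := by
    rw [Finset.mul_sum, ← Finset.sum_add_distrib]
    exact Finset.sum_congr rfl fun v _ => by ring
  rw [h1, h0] at h
  linarith

end
end

section
/- There exists an absolute constant a > 0 (independent of s, n, γ, z) with the following property: for every n ≥ 1 with N = 2^n, every s ∈ ℕ, every strictly positive weights γ, and every z = (z_1,…,z_s) ∈ {1,…,N−1}^s with gcd(z_j, N) = 1 for all j that satisfies H_{s,n,γ}(z) ≤ N · Σ_{∅≠v⊆{1,…,s}} (log 4)^{|v|} γ_v, one has T_{1,γ}(N,z) ≤ (1 + log N) · Σ_{∅≠u⊆{1,…,s}} (γ_u/N)(a log N)^{|u|}. -/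
open Finset MeasureTheory

noncomputable section

lemma s7_tailFin (ζ : ℂ) (hζ : ‖ζ‖ ≤ 1) (N : ℕ) (hN : 1 ≤ N) (M : ℕ) (hM : N ≤ M) :
    ‖(1 - ζ) * ((∑ m ∈ range M, ζ ^ m / m) - ∑ m ∈ range N, ζ ^ m / m) + ζ ^ M / M‖
      ≤ 2 / N - 1 / M := by
  induction M, hM using Nat.le_induction with
  | base =>
    simp only [sub_self, mul_zero, zero_add, norm_div, norm_pow, Complex.norm_natCast]
    rw [← sub_div]
    gcongr
    norm_num
    exact pow_le_one₀ (norm_nonneg _) hζ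
  | succ M hM ih =>
    have hM0 : (M : ℂ) ≠ 0 := by
      have : M ≠ 0 := by omega
      exact_mod_cast this
    have hM1 : ((M : ℂ) + 1) ≠ 0 := by exact_mod_cast Nat.succ_ne_zero M
    have hMr : (0 : ℝ) < M := by
      have : 0 < M := by omega
      exact_mod_cast this
    have e : (1 - ζ) * ((∑ m ∈ range (M + 1), ζ ^ m / m) - ∑ m ∈ range N, ζ ^ m / m)
        + ζ ^ (M + 1) / ((M + 1 : ℕ) : ℂ) =
        ((1 - ζ) * ((∑ m ∈ range M, ζ ^ m / m) - ∑ m ∈ range N, ζ ^ m / m) + ζ ^ M / M)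
          - ζ ^ (M + 1) * ((1 / M - 1 / (M + 1) : ℝ) : ℂ) := by
      rw [sum_range_succ]
      push_cast
      field_simp
      ring
    rw [e]
    refine (norm_sub_le _ _).trans ?_
    have h2 : ‖ζ ^ (M + 1) * ((1 / M - 1 / (M + 1) : ℝ) : ℂ)‖ ≤ 1 / M - 1 / (M + 1) := by
      have h0 : (0 : ℝ) ≤ 1 / M - 1 / (M + 1) := by
        rw [sub_nonneg]
        gcongr
        linarith
      rw [norm_mul, norm_pow, Complex.norm_real, Real.norm_of_nonneg h0]
      exact mul_le_of_le_one_left h0 (pow_le_one₀ (norm_nonneg _) hζ)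
    have h3 : ((M + 1 : ℕ) : ℝ) = M + 1 := by push_cast; rfl
    rw [h3]
    linarith

lemma s7_tail (ζ : ℂ) (hζ : ‖ζ‖ < 1) (N : ℕ) (hN : 1 ≤ N) :
    ‖(1 - ζ) * (-Complex.log (1 - ζ) - ∑ m ∈ range N, ζ ^ m / m)‖ ≤ 2 / N := by
  have h1 := (Complex.hasSum_taylorSeries_neg_log hζ).tendsto_sum_nat
  have h3 : Filter.Tendsto (fun M : ℕ => ζ ^ M / (M : ℂ)) Filter.atTop (nhds 0) :=
    (Complex.hasSum_taylorSeries_neg_log hζ).summable.tendsto_atTop_zero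
  have h4 := (((h1.sub_const (∑ m ∈ range N, ζ ^ m / m)).const_mul (1 - ζ)).add h3).norm
  rw [add_zero] at h4
  refine le_of_tendsto h4 ?_
  filter_upwards [Filter.eventually_ge_atTop N] with M hM
  have := s7_tailFin ζ hζ.le N hN M hM
  have : (0 : ℝ) ≤ 1 / M := by positivity
  linarith

lemma s7_tailB (w : ℂ) (hw : ‖w‖ = 1) (hw1 : w ≠ 1) (N : ℕ) (hN : 1 ≤ N) :
    ‖(1 - w) * (-Complex.log (1 - w) - ∑ m ∈ range N, w ^ m / m)‖ ≤ 2 / N := by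
  have hre : w.re < 1 := by
    rcases lt_or_eq_of_le ((Complex.re_le_norm w).trans hw.le) with h | h
    · exact h
    · exfalso
      apply hw1
      have h2 := Complex.sq_norm w
      rw [hw, Complex.normSq_apply, h] at h2
      have : w.im = 0 := by nlinarith
      exact Complex.ext (by simpa using h) (by simpa using this)
  have hs : 1 - w ∈ Complex.slitPlane := by
    left
    simp
    linarith
  have hc : ContinuousAt (fun r : ℝ => ‖(1 - r * w) * (-Complex.log (1 - r * w)
      - ∑ m ∈ range N, (r * w) ^ m / m)‖) 1 := by
    refine ContinuousAt.norm (ContinuousAt.mul (by fun_prop) (ContinuousAt.sub (ContinuousAt.neg ?_) ?_))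
    · apply ContinuousAt.clog
      · fun_prop
      · simpa using hs
    · fun_prop
  have h5 : Filter.Tendsto (fun r : ℝ => ‖(1 - r * w) * (-Complex.log (1 - r * w)
      - ∑ m ∈ range N, (r * w) ^ m / m)‖) (nhdsWithin 1 (Set.Iio 1)) (nhds _) :=
    hc.tendsto.mono_left nhdsWithin_le_nhds
  have := le_of_tendsto (b := 2 / (N : ℝ)) h5 (by
    have : Set.Ioo (0 : ℝ) 1 ∈ nhdsWithin (1 : ℝ) (Set.Iio 1) := Ioo_mem_nhdsLT (by norm_num)
    filter_upwards [this] with r hr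
    apply s7_tail _ _ N hN
    rw [norm_mul, hw, Complex.norm_real, Real.norm_of_nonneg hr.1.le]
    linarith [hr.2])
  simpa using this

def s7S (N : ℕ) (x : ℝ) : ℝ := ∑ m ∈ Ico 1 N, 2 * Real.cos (2 * Real.pi * m * x) / m

def s7e (x : ℝ) : ℂ := Complex.exp ((2 * Real.pi * x : ℝ) * Complex.I)

lemma s7e_re (x : ℝ) : (s7e x).re = Real.cos (2 * Real.pi * x) := Complex.exp_ofReal_mul_I_re _
lemma s7e_im (x : ℝ) : (s7e x).im = Real.sin (2 * Real.pi * x) := Complex.exp_ofReal_mul_I_im _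
lemma s7e_norm (x : ℝ) : ‖s7e x‖ = 1 := Complex.norm_exp_ofReal_mul_I _
lemma s7e_add (x y : ℝ) : s7e (x + y) = s7e x * s7e y := by
  rw [s7e, s7e, s7e, ← Complex.exp_add]; congr 1; push_cast; ring
lemma s7e_zero : s7e 0 = 1 := by simp [s7e]
lemma s7e_pow (x : ℝ) (k : ℕ) : s7e x ^ k = s7e (k * x) := by
  rw [s7e, s7e, ← Complex.exp_nat_mul]; congr 1; push_cast; ring
lemma s7e_sum {ι : Type*} (t : Finset ι) (f : ι → ℝ) : s7e (∑ i ∈ t, f i) = ∏ i ∈ t, s7e (f i) := by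
  classical
  induction t using Finset.induction_on with
  | empty => simp [s7e_zero]
  | insert a t ha ih => rw [sum_insert ha, prod_insert ha, s7e_add, ih]

lemma s7_norm_one_sub (x : ℝ) : ‖1 - s7e x‖ = 2 * |Real.sin (Real.pi * x)| := by
  have h : ‖1 - s7e x‖ ^ 2 = (2 * |Real.sin (Real.pi * x)|) ^ 2 := by
    rw [Complex.sq_norm, Complex.normSq_apply, mul_pow, sq_abs]
    simp only [Complex.sub_re, Complex.sub_im, Complex.one_re, Complex.one_im, s7e_re, s7e_im]
    have : 2 * Real.pi * x = 2 * (Real.pi * x) := by ring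
    rw [this, Real.cos_two_mul, Real.sin_two_mul]
    nlinarith [Real.sin_sq_add_cos_sq (Real.pi * x)]
  exact (pow_left_inj₀ (norm_nonneg _) (by positivity) two_ne_zero).1 h

lemma s7_err (N : ℕ) (hN : 1 ≤ N) (x : ℝ) (hx : Real.sin (Real.pi * x) ≠ 0) :
    |Real.log 4 + s7S N x - lsin x| ≤ 2 / (N * |Real.sin (Real.pi * x)|) := by
  have hsp : 0 < |Real.sin (Real.pi * x)| := abs_pos.2 hx
  have hn := s7_norm_one_sub x
  have hw1 : s7e x ≠ 1 := by
    intro h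
    rw [h] at hn
    simp at hn
    exact hx hn
  have hB := s7_tailB (s7e x) (s7e_norm x) hw1 N hN
  rw [norm_mul, hn] at hB
  have hre := Complex.abs_re_le_norm (-Complex.log (1 - s7e x) - ∑ m ∈ range N, s7e x ^ m / m)
  have e1 : (-Complex.log (1 - s7e x) - ∑ m ∈ range N, s7e x ^ m / m).re
      = -(Real.log 4 + s7S N x - lsin x) / 2 := by
    rw [Complex.sub_re, Complex.neg_re, Complex.log_re, hn, Complex.re_sum]
    have e2 : ∑ m ∈ range N, (s7e x ^ m / (m : ℂ)).re = s7S N x / 2 := by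
      rw [s7S, Finset.sum_div, ← Finset.sum_subset (s₁ := Ico 1 N) (s₂ := range N)]
      · apply sum_congr rfl
        intro m hm
        rw [Complex.div_natCast_re, s7e_pow, s7e_re]
        ring_nf
      · intro m hm
        simp at hm ⊢
        exact hm.2
      · intro m hm hm2
        simp at hm hm2
        have : m = 0 := by omega
        subst this
        simp
    rw [e2, lsin, Real.log_mul two_ne_zero hsp.ne', Real.log_abs, one_div, Real.log_inv, Real.log_pow,
      show (4 : ℝ) = 2 ^ 2 by norm_num, Real.log_pow]
    push_cast
    ring
  rw [e1, abs_div, abs_neg, abs_two] at hre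
  have hNr : (0 : ℝ) < N := by exact_mod_cast hN
  rw [le_div_iff₀ (by positivity)]
  rw [le_div_iff₀ hNr] at hB
  have : |Real.log 4 + s7S N x - lsin x| * (N * |Real.sin (Real.pi * x)|) ≤
    2 * |Real.sin (Real.pi * x)| * ‖-Complex.log (1 - s7e x) - ∑ m ∈ range N, s7e x ^ m / m‖ * N := by
    have h7 : 0 ≤ |Real.sin (Real.pi * x)| * N := by positivity
    nlinarith
  linarith

/-- sine lower bound -/
lemma s7_sin (N b : ℕ) (hb : 1 ≤ b) (hbN : b < N) :
    1 / Real.sin (Real.pi * (b / N)) ≤ N / 2 * (1 / b + 1 / (N - b : ℕ)) ∧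
    2 / N ≤ Real.sin (Real.pi * (b / N)) := by
  have hN : (0 : ℝ) < N := by exact_mod_cast (by omega : 0 < N)
  have hb' : (1 : ℝ) ≤ b := by exact_mod_cast hb
  have hc' : (1 : ℝ) ≤ (N - b : ℕ) := by exact_mod_cast (by omega : 1 ≤ N - b)
  have hcb : ((N - b : ℕ) : ℝ) = N - b := by rw [Nat.cast_sub hbN.le]
  have key : ∀ c : ℝ, 1 ≤ c → c ≤ N / 2 → 2 * c / N ≤ Real.sin (Real.pi * (c / N)) := by
    intro c hc hcN
    have := Real.mul_le_sin (x := Real.pi * (c / N)) (by have := Real.pi_pos; positivity) (by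
      have := Real.pi_pos
      have : c / N ≤ 1 / 2 := by rw [div_le_iff₀ hN]; linarith
      nlinarith)
    calc 2 * c / N = 2 / Real.pi * (Real.pi * (c / N)) := by field_simp
      _ ≤ _ := this
  have main : ∀ c d : ℝ, 1 ≤ c → 1 ≤ d → c ≤ N / 2 → 
      Real.sin (Real.pi * (b / N)) = Real.sin (Real.pi * (c / N)) → 
      1 / Real.sin (Real.pi * (b / N)) ≤ N / 2 * (1 / c + 1 / d) ∧
      2 / N ≤ Real.sin (Real.pi * (b / N)) := by
    intro c d hc hd hcN h
    have h1 := key c hc hcN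
    rw [h]
    constructor
    · calc 1 / Real.sin (Real.pi * (c / N)) ≤ 1 / (2 * c / N) := by gcongr
        _ = N / 2 * (1 / c + 0) := by field_simp; ring
        _ ≤ _ := by gcongr; positivity
    · refine le_trans ?_ h1
      gcongr
      linarith
  rcases le_total (b : ℝ) (N / 2) with h | h
  · exact main b _ hb' hc' h rfl
  · rw [add_comm]
    refine main _ b hc' hb' (by rw [hcb]; linarith) ?_
    rw [hcb, ← Real.sin_pi_sub]
    congr 1
    field_simp

lemma s7_harm (N : ℕ) (_hN : 2 ≤ N) : ∑ m ∈ Ico 1 N, (1 : ℝ) / m ≤ 1 + Real.log N := by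
  have h := harmonic_le_one_add_log N
  refine le_trans ?_ h
  rw [harmonic_eq_sum_Icc]
  push_cast
  simp only [one_div]
  apply sum_le_sum_of_subset_of_nonneg
  · intro m hm
    simp at hm ⊢
    omega
  · intros; positivity

lemma s7_harm2 (N : ℕ) (hN : 2 ≤ N) :
    ∑ m ∈ Ico 1 N, ((1 : ℝ) / m + 1 / (N - m : ℕ)) ≤ 2 * (1 + Real.log N) := by
  have h := s7_harm N hN
  rw [sum_add_distrib]
  have : ∑ m ∈ Ico 1 N, (1 : ℝ) / (N - m : ℕ) = ∑ m ∈ Ico 1 N, (1 : ℝ) / m := by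
    apply sum_nbij' (fun m => N - m) (fun m => N - m) <;> intro m hm <;> simp at hm ⊢ <;> omega
  rw [this]
  linarith

lemma s7_abs_sin_mod (N : ℕ) (hN : 0 < N) (a : ℤ) :
    |Real.sin (Real.pi * (a / N))| = |Real.sin (Real.pi * (((a % N).toNat : ℕ) / N))| := by
  have h1 : ((a % N).toNat : ℤ) = a % N := Int.toNat_of_nonneg (Int.emod_nonneg _ (by omega))
  have h2 : (a : ℝ) = ((a % N).toNat : ℕ) + N * (a / N : ℤ) := by
    have := Int.emod_add_mul_ediv a N
    rw [← h1] at this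
    exact_mod_cast this.symm
  have hNr : (N : ℝ) ≠ 0 := by positivity
  have h3 : Real.pi * (a / N) = Real.pi * (((a % N).toNat : ℕ) / N) + (a / N : ℤ) * Real.pi := by
    rw [h2]
    field_simp
  rw [h3, Real.sin_add_int_mul_pi, abs_mul, abs_zpow]
  simp

lemma s7_char (N : ℕ) (hN : 0 < N) (t : ℤ) :
    ∑ k ∈ range N, s7e (k * ((t : ℝ) / N)) = if t % (N : ℤ) = 0 then (N : ℂ) else 0 := by
  have hNr : (N : ℝ) ≠ 0 := by positivity
  have hNc : (N : ℂ) ≠ 0 := by exact_mod_cast hN.ne'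
  have hpi : (Real.pi : ℂ) ≠ 0 := by exact_mod_cast Real.pi_ne_zero
  simp only [← s7e_pow]
  have hiff : s7e ((t : ℝ) / N) = 1 ↔ t % (N : ℤ) = 0 := by
    rw [s7e, Complex.exp_eq_one_iff, ← Int.dvd_iff_emod_eq_zero]
    constructor
    · rintro ⟨q, hq⟩
      refine ⟨q, ?_⟩
      push_cast at hq
      have h2 : (t : ℂ) = N * q := by
        have hI := Complex.I_ne_zero
        field_simp at hq
        linear_combination hq
      exact_mod_cast h2
    · rintro ⟨q, hq⟩
      refine ⟨q, ?_⟩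
      rw [hq]
      push_cast
      field_simp
  split_ifs with h
  · rw [hiff.2 h]; simp
  · have hne : s7e ((t : ℝ) / N) ≠ 1 := fun h' => h (hiff.1 h')
    have h1 : s7e ((t : ℝ) / N) ^ N = 1 := by
      rw [s7e_pow, mul_div_cancel₀ _ hNr, s7e, Complex.exp_eq_one_iff]
      exact ⟨t, by push_cast; ring⟩
    rw [geom_sum_eq hne, h1]
    simp

def s7c (m : ℤ) : ℝ := if m = 0 then 1 else 1 / |(m : ℝ)|

lemma s7c_nonneg (m : ℤ) : 0 ≤ s7c m := by
  unfold s7c; split_ifs <;> positivity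

def s7I (N : ℕ) : Finset ℤ := (Icc (-(N : ℤ) + 1) ((N : ℤ) - 1)).erase 0

lemma s7_symm (N : ℕ) (x : ℝ) :
    ∑ m ∈ s7I N, (s7c m : ℂ) * s7e (m * x) = (s7S N x : ℂ) := by
  have hI : s7I N = (Ico 1 N).image (fun m : ℕ => (m : ℤ)) ∪
      (Ico 1 N).image (fun m : ℕ => -(m : ℤ)) := by
    ext m
    simp only [s7I, mem_erase, mem_Icc, mem_union, mem_image, mem_Ico]
    constructor
    · rintro ⟨h0, h1, h2⟩
      rcases lt_or_gt_of_ne h0 with h | h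
      · right; exact ⟨m.natAbs, by omega, by omega⟩
      · left; exact ⟨m.natAbs, by omega, by omega⟩
    · rintro (⟨a, h, rfl⟩ | ⟨a, h, rfl⟩) <;> omega
  rw [hI, sum_union, sum_image, sum_image, ← sum_add_distrib, s7S, Complex.ofReal_sum]
  · apply sum_congr rfl
    intro m hm
    simp only [mem_Ico] at hm
    have hm0 : m ≠ 0 := by omega
    have h1 : s7c (m : ℤ) = 1 / m := by simp [s7c, hm0]
    have h2 : s7c (-(m : ℤ)) = 1 / m := by simp [s7c, hm0]
    rw [h1, h2]
    apply Complex.ext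
    · rw [Complex.add_re, Complex.re_ofReal_mul, Complex.re_ofReal_mul, s7e_re, s7e_re,
        Complex.ofReal_re]
      push_cast
      rw [show 2 * Real.pi * (-(m : ℝ) * x) = -(2 * Real.pi * (m * x)) by ring, Real.cos_neg,
        show 2 * Real.pi * (m * x) = 2 * Real.pi * m * x by ring]
      ring
    · rw [Complex.add_im, Complex.im_ofReal_mul, Complex.im_ofReal_mul, s7e_im, s7e_im,
        Complex.ofReal_im]
      push_cast
      rw [show 2 * Real.pi * (-(m : ℝ) * x) = -(2 * Real.pi * (m * x)) by ring, Real.sin_neg]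
      ring
  · intro a _ b _ h
    simpa using h
  · intro a _ b _ h
    simpa using h
  · rw [Finset.disjoint_left]
    intro m h1 h2
    simp only [mem_image, mem_Ico] at h1 h2
    omega

def s7A (N s : ℕ) (u : Finset ℕ) : Finset (Fin s → ℤ) :=
  Fintype.piFinset fun j : Fin s => if (j : ℕ) + 1 ∈ u then s7I N else {0}

def s7M (N s : ℕ) (z : ℕ → ℤ) (u : Finset ℕ) : ℝ :=
  ∑ m ∈ (s7A N s u).filter (fun m => (∑ j : Fin s, m j * z ((j : ℕ) + 1)) % (N : ℤ) = 0),
    ∏ j, s7c (m j)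

lemma s7M_nonneg (N s : ℕ) (z : ℕ → ℤ) (u : Finset ℕ) : 0 ≤ s7M N s z u :=
  sum_nonneg fun _ _ => prod_nonneg fun _ _ => s7c_nonneg _

lemma s7_prod_fin {R : Type*} [CommMonoid R] (s : ℕ) (u : Finset ℕ) (hu : u ⊆ Icc 1 s) (g : ℕ → R) :
    ∏ j ∈ u, g j = ∏ j : Fin s, if (j : ℕ) + 1 ∈ u then g ((j : ℕ) + 1) else 1 := by
  rw [← Finset.prod_range (fun j => if j + 1 ∈ u then g (j + 1) else 1), ← Finset.prod_filter]
  symm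
  apply prod_nbij' (fun j => j + 1) (fun j => j - 1)
  · intro a ha; simp at ha; exact ha.2
  · intro a ha
    have := mem_Icc.1 (hu ha)
    simp only [mem_filter, mem_range]
    rw [Nat.sub_add_cancel this.1]
    exact ⟨by omega, ha⟩
  · intro a ha; simp
  · intro a ha
    have := mem_Icc.1 (hu ha)
    exact Nat.sub_add_cancel this.1
  · intros; rfl

lemma s7_sum_prod (N : ℕ) (hN : 0 < N) (s : ℕ) (z : ℕ → ℤ) (u : Finset ℕ) (hu : u ⊆ Icc 1 s) :
    ∑ k ∈ range N, ∏ j ∈ u, s7S N ((k : ℝ) * (z j : ℝ) / N) = N * s7M N s z u := by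
  have : ((∑ k ∈ range N, ∏ j ∈ u, s7S N ((k : ℝ) * (z j : ℝ) / N) : ℝ) : ℂ)
      = ((N * s7M N s z u : ℝ) : ℂ) := by
    rw [Complex.ofReal_sum]
    have h1 : ∀ k ∈ range N, ((∏ j ∈ u, s7S N ((k : ℝ) * (z j : ℝ) / N) : ℝ) : ℂ)
        = ∑ m ∈ s7A N s u, ((∏ j, s7c (m j) : ℝ) : ℂ) *
          s7e (k * (((∑ j : Fin s, m j * z ((j : ℕ) + 1) : ℤ) : ℝ) / N)) := by
      intro k _
      rw [Complex.ofReal_prod, s7_prod_fin s u hu]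
      have h2 : ∀ j : Fin s, (if (j : ℕ) + 1 ∈ u then
          ((s7S N ((k : ℝ) * (z ((j : ℕ) + 1) : ℝ) / N) : ℝ) : ℂ) else 1)
          = ∑ m ∈ (if (j : ℕ) + 1 ∈ u then s7I N else {0}),
            (s7c m : ℂ) * s7e (m * ((k : ℝ) * (z ((j : ℕ) + 1) : ℝ) / N)) := by
        intro j
        split_ifs
        · rw [s7_symm]
        · simp [s7c, s7e_zero]
      rw [prod_congr rfl (fun j _ => h2 j), Finset.prod_univ_sum]
      apply sum_congr rfl
      intro m _
      rw [prod_mul_distrib, Complex.ofReal_prod, ← s7e_sum]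
      congr 2
      push_cast
      rw [sum_div, mul_sum]
      apply sum_congr rfl
      intro j _
      ring
    rw [sum_congr rfl h1, sum_comm]
    simp only [← mul_sum]
    rw [s7M, sum_filter, Complex.ofReal_mul, Complex.ofReal_sum, Complex.ofReal_natCast, mul_sum]
    apply sum_congr rfl
    intro m _
    rw [s7_char N hN]
    split_ifs
    · push_cast; ring
    · simp
  exact_mod_cast this

lemma s7_mem_A (N s : ℕ) (u : Finset ℕ) (hu : u ⊆ Icc 1 s) (hN : 1 ≤ N) (m : Fin s → ℤ) :
    m ∈ s7A N s u ↔ m ∈ (Fintype.piFinset fun _ : Fin s =>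
      Finset.Icc (-(N : ℤ) + 1) ((N : ℤ) - 1)) ∧ msupp m = u := by
  have hms : msupp m = u ↔ ∀ j : Fin s, (m j ≠ 0 ↔ (j : ℕ) + 1 ∈ u) := by
    constructor
    · rintro rfl j
      simp only [msupp, mem_image, mem_filter, mem_univ, true_and]
      constructor
      · intro h; exact ⟨j, h, rfl⟩
      · rintro ⟨i, hi, he⟩
        have : i = j := Fin.ext (by omega)
        exact this ▸ hi
    · intro h
      ext a
      simp only [msupp, mem_image, mem_filter, mem_univ, true_and]
      constructor
      · rintro ⟨i, hi, rfl⟩; exact (h i).1 hi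
      · intro ha
        have := mem_Icc.1 (hu ha)
        have he : a - 1 + 1 = a := Nat.sub_add_cancel this.1
        refine ⟨⟨a - 1, by omega⟩, (h _).2 ?_, he⟩
        simpa [he] using ha
  rw [hms]
  simp only [s7A, Fintype.mem_piFinset]
  rw [← forall_and]
  apply forall_congr'
  intro j
  split_ifs with h
  · simp only [s7I, mem_erase, h, iff_true]
    tauto
  · simp only [mem_singleton, h, iff_false, not_not, mem_Icc]
    constructor
    · intro h; rw [h]; constructor <;> omega
    · tauto

lemma s7_T (N : ℕ) (hN : 1 ≤ N) (s : ℕ) (γ : Finset ℕ → ℝ) (z : ℕ → ℤ) :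
    Tsum 1 γ N s z = ∑ u ∈ (Finset.Icc 1 s).powerset.filter (· ≠ ∅), γ u * s7M N s z u := by
  unfold Tsum
  rw [← Finset.sum_fiberwise_of_maps_to (t := (Finset.Icc 1 s).powerset.filter (· ≠ ∅))
    (g := fun m => msupp m)]
  · apply sum_congr rfl
    intro u hu
    simp only [mem_filter, mem_powerset] at hu
    rw [s7M, mul_sum]
    have hset : (((Fintype.piFinset fun _ : Fin s =>
        Finset.Icc (-(N : ℤ) + 1) ((N : ℤ) - 1)).filter
        (fun m => m ≠ 0 ∧ (∑ j : Fin s, m j * z ((j : ℕ) + 1)) % (N : ℤ) = 0)).filter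
        (fun m => msupp m = u)) = (s7A N s u).filter
        (fun m => (∑ j : Fin s, m j * z ((j : ℕ) + 1)) % (N : ℤ) = 0) := by
      ext m
      rw [mem_filter, mem_filter, mem_filter, s7_mem_A N s u hu.1 hN]
      constructor
      · tauto
      · rintro ⟨⟨h1, h2⟩, h3⟩
        refine ⟨⟨h1, ?_, h3⟩, h2⟩
        rintro rfl
        apply hu.2
        rw [← h2]
        simp [msupp]
    rw [hset]
    apply sum_congr rfl
    intro m hm
    rw [mem_filter, s7_mem_A N s u hu.1 hN] at hm
    rw [rweight, hm.1.2, prod_filter, one_div, mul_inv, inv_inv, ← prod_inv_distrib]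
    congr 1
    apply prod_congr rfl
    intro j _
    rw [s7c]
    by_cases h : m j = 0 <;> simp [h]
  · intro m hm
    simp only [mem_filter] at hm
    simp only [mem_filter, mem_powerset]
    constructor
    · intro a ha
      simp only [msupp, mem_image] at ha
      obtain ⟨i, _, rfl⟩ := ha
      rw [mem_Icc]
      omega
    · intro h
      apply hm.2.1
      ext j
      by_contra hj
      have : (j : ℕ) + 1 ∈ msupp m := mem_image.2 ⟨j, by simpa using hj, rfl⟩
      rw [h] at this
      simp at this

lemma s7_prod_diff {ι : Type*} (u : Finset ι) (a b : ι → ℝ) (B : ℝ) (hB : 1 ≤ B)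
    (ha : ∀ j ∈ u, |a j| ≤ B) (hb : ∀ j ∈ u, |b j| ≤ B) :
    |∏ j ∈ u, b j - ∏ j ∈ u, a j| ≤ (∑ j ∈ u, |b j - a j|) * B ^ u.card := by
  classical
  induction u using Finset.induction_on with
  | empty => simp
  | insert i u hi ih =>
    have ih' := ih (fun j hj => ha j (mem_insert_of_mem hj)) (fun j hj => hb j (mem_insert_of_mem hj))
    rw [prod_insert hi, prod_insert hi, sum_insert hi, card_insert_of_notMem hi]
    have hp : |∏ j ∈ u, a j| ≤ B ^ u.card := by
      rw [abs_prod]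
      rw [← prod_const]
      exact prod_le_prod (fun _ _ => abs_nonneg _) (fun j hj => ha j (mem_insert_of_mem hj))
    have hbi := hb i (mem_insert_self _ _)
    have hBp : (0 : ℝ) ≤ B ^ u.card := by positivity
    calc |b i * ∏ j ∈ u, b j - a i * ∏ j ∈ u, a j|
        = |b i * (∏ j ∈ u, b j - ∏ j ∈ u, a j) + (b i - a i) * ∏ j ∈ u, a j| := by ring_nf
      _ ≤ |b i| * |∏ j ∈ u, b j - ∏ j ∈ u, a j| + |b i - a i| * |∏ j ∈ u, a j| := by
          rw [← abs_mul, ← abs_mul]; exact abs_add_le _ _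
      _ ≤ B * ((∑ j ∈ u, |b j - a j|) * B ^ u.card) + |b i - a i| * (B ^ u.card * B) := by
          gcongr
          exact hp.trans (le_mul_of_one_le_right hBp hB)
      _ = _ := by ring

def s7b (N : ℕ) (z : ℤ) (k : ℕ) : ℕ := (((k : ℤ) * z) % (N : ℤ)).toNat

lemma s7b_mem (N : ℕ) (z : ℤ) (hz : IsCoprime (N : ℤ) z) (k : ℕ) (hk : k ∈ Ico 1 N) :
    s7b N z k ∈ Ico 1 N := by
  rw [mem_Ico] at hk ⊢
  have h1 := Int.emod_nonneg ((k : ℤ) * z) (by omega : (N : ℤ) ≠ 0)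
  have h2 := Int.emod_lt_of_pos ((k : ℤ) * z) (by omega : (0 : ℤ) < N)
  have h3 : ((k : ℤ) * z) % (N : ℤ) ≠ 0 := by
    intro h
    have h4 := hz.dvd_of_dvd_mul_right (Int.dvd_of_emod_eq_zero h)
    have := Int.le_of_dvd (by omega) h4
    omega
  unfold s7b
  omega

lemma s7b_inj (N : ℕ) (z : ℤ) (hz : IsCoprime (N : ℤ) z) :
    Set.InjOn (s7b N z) (Ico 1 N : Finset ℕ) := by
  intro k hk l hl h
  simp only [coe_Ico, Set.mem_Ico] at hk hl
  have h1 := Int.emod_nonneg ((k : ℤ) * z) (by omega : (N : ℤ) ≠ 0)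
  have h2 := Int.emod_nonneg ((l : ℤ) * z) (by omega : (N : ℤ) ≠ 0)
  unfold s7b at h
  have h3 : ((k : ℤ) * z) % (N : ℤ) = ((l : ℤ) * z) % (N : ℤ) := by omega
  have h4 : (N : ℤ) ∣ ((k : ℤ) - l) * z := by
    have := Int.emod_emod_of_dvd
    rw [sub_mul]
    exact Int.dvd_of_emod_eq_zero (Int.emod_eq_emod_iff_emod_sub_eq_zero.1 h3)
  have h5 := hz.dvd_of_dvd_mul_right h4
  have h6 := Int.eq_zero_of_abs_lt_dvd h5 (by rw [abs_lt]; omega)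
  omega

lemma s7_facts (N : ℕ) (z : ℤ) (hz : IsCoprime (N : ℤ) z) (k : ℕ) (hk : k ∈ Ico 1 N) :
    |Real.log 4 + s7S N ((k : ℝ) * z / N) - lsin ((k : ℝ) * z / N)| ≤
      1 / (s7b N z k : ℝ) + 1 / ((N - s7b N z k : ℕ) : ℝ) ∧
    |Real.log 4 + s7S N ((k : ℝ) * z / N) - lsin ((k : ℝ) * z / N)| ≤ 1 ∧
    0 ≤ lsin ((k : ℝ) * z / N) ∧ lsin ((k : ℝ) * z / N) ≤ 2 * Real.log N := by
  have hb := s7b_mem N z hz k hk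
  rw [mem_Ico] at hk hb
  have hN : 0 < N := by omega
  have hNr : (0 : ℝ) < N := by exact_mod_cast hN
  have hm := s7_abs_sin_mod N hN ((k : ℤ) * z)
  have hs := s7_sin N _ hb.1 hb.2
  have hpos : 0 < Real.sin (Real.pi * ((s7b N z k : ℕ) / N)) := lt_of_lt_of_le (by positivity) hs.2
  change _ = |Real.sin (Real.pi * ((s7b N z k : ℕ) / N))| at hm
  rw [abs_of_pos hpos] at hm
  push_cast at hm
  set σ := Real.sin (Real.pi * ((s7b N z k : ℕ) / N)) with hσ
  have hne : Real.sin (Real.pi * ((k : ℝ) * z / N)) ≠ 0 := by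
    rw [← abs_pos, hm]; exact hpos
  have he := s7_err N hN _ hne
  rw [hm] at he
  have hL : lsin ((k : ℝ) * z / N) = - (2 * Real.log σ) := by
    rw [lsin, one_div, Real.log_inv, ← sq_abs, hm, Real.log_pow]; norm_num
  have hσ1 : σ ≤ 1 := Real.sin_le_one _
  refine ⟨he.trans ?_, he.trans ?_, ?_, ?_⟩
  · calc 2 / (N * σ) = 2 / N * (1 / σ) := by field_simp
      _ ≤ 2 / N * (N / 2 * (1 / (s7b N z k : ℝ) + 1 / ((N - s7b N z k : ℕ) : ℝ))) := by
        gcongr; exact hs.1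
      _ = _ := by field_simp
  · rw [div_le_one (by positivity)]
    have := hs.2
    rw [div_le_iff₀ hNr] at this
    linarith
  · rw [hL]
    have := Real.log_nonpos hpos.le hσ1
    linarith
  · rw [hL]
    have h1 : Real.log (1 / N) ≤ Real.log σ := by
      apply Real.log_le_log (by positivity)
      refine le_trans ?_ hs.2
      gcongr
      norm_num
    rw [one_div, Real.log_inv] at h1
    linarith

lemma s7_sum_err (N : ℕ) (hN : 2 ≤ N) (z : ℤ) (hz : IsCoprime (N : ℤ) z) :
    ∑ k ∈ Ico 1 N, |Real.log 4 + s7S N ((k : ℝ) * z / N) - lsin ((k : ℝ) * z / N)|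
      ≤ 2 * (1 + Real.log N) := by
  refine le_trans (sum_le_sum fun k hk => (s7_facts N z hz k hk).1) ?_
  refine le_trans ?_ (s7_harm2 N hN)
  rw [← sum_image (s := Ico 1 N) (g := s7b N z)
    (f := fun b : ℕ => 1 / (b : ℝ) + 1 / ((N - b : ℕ) : ℝ)) (s7b_inj N z hz)]
  apply sum_le_sum_of_subset_of_nonneg
  · intro b hb
    obtain ⟨k, hk, rfl⟩ := mem_image.1 hb
    exact s7b_mem N z hz k hk
  · intros; positivity

lemma s7_M_bound (N : ℕ) (hN : 0 < N) (s : ℕ) (z : ℕ → ℤ) (u : Finset ℕ) (hu : u ⊆ Icc 1 s)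
    (hne : u ≠ ∅) :
    N * s7M N s z u + N * Real.log 4 ^ u.card ≤
      ∑ k ∈ range N, ∏ j ∈ u, (Real.log 4 + s7S N ((k : ℝ) * (z j : ℝ) / N)) := by
  have hl : 0 ≤ Real.log 4 := Real.log_nonneg (by norm_num)
  simp only [prod_add]
  rw [sum_comm]
  have h : ∀ t ∈ u.powerset, ∑ k ∈ range N, (∏ j ∈ t, Real.log 4) *
      ∏ j ∈ u \ t, s7S N ((k : ℝ) * (z j : ℝ) / N) = Real.log 4 ^ t.card * (N * s7M N s z (u \ t)) := by
    intro t ht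
    rw [← mul_sum, s7_sum_prod N hN s z _ (sdiff_subset.trans hu), prod_const]
  rw [sum_congr rfl h]
  have h0 : s7M N s z ∅ = 1 := by
    have h1 := s7_sum_prod N hN s z ∅ (empty_subset _)
    have hNr : (N : ℝ) ≠ 0 := by positivity
    simp only [prod_empty, sum_const, card_range, nsmul_eq_mul, mul_one] at h1
    exact (mul_left_cancel₀ hNr (by rw [mul_one]; exact h1)).symm
  have hsub : ({∅, u} : Finset (Finset ℕ)) ⊆ u.powerset := by
    intro t ht
    simp only [mem_insert, mem_singleton] at ht
    rcases ht with rfl | rfl <;> simp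
  refine le_trans (le_of_eq ?_) (sum_le_sum_of_subset_of_nonneg hsub ?_)
  · rw [sum_pair hne.symm]
    simp only [card_empty, pow_zero, one_mul, sdiff_empty, sdiff_self, bot_eq_empty, h0]
    ring
  · intro t _ _
    have := s7M_nonneg N s z (u \ t)
    positivity

lemma s7_final (c : ℕ) (hc : 1 ≤ c) (l : ℝ) (hl : 1 / 2 ≤ l) :
    (8 * l) ^ c + c * (2 * (1 + l)) * (4 * l) ^ c ≤ (1 + l) * (64 * l) ^ c := by
  have h1 : (c : ℝ) ≤ 2 ^ c := by exact_mod_cast Nat.lt_two_pow_self.le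
  have h2 : (4 * l) ^ c * 2 ^ c = (8 * l) ^ c := by rw [← mul_pow]; ring
  have h3 : (64 * l) ^ c = (8 * l) ^ c * 8 ^ c := by rw [← mul_pow]; ring
  have h4 : (8 : ℝ) ≤ 8 ^ c := by
    calc (8 : ℝ) = 8 ^ 1 := by norm_num
      _ ≤ 8 ^ c := pow_le_pow_right₀ (by norm_num) hc
  have hp : 0 ≤ (8 * l) ^ c := by positivity
  have hp4 : 0 ≤ (4 * l) ^ c := by positivity
  calc (8 * l) ^ c + c * (2 * (1 + l)) * (4 * l) ^ c
      ≤ (1 + l) * (8 * l) ^ c + 2 ^ c * (2 * (1 + l)) * (4 * l) ^ c := by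
        gcongr
        nlinarith
    _ = (1 + l) * (8 * l) ^ c * 3 := by rw [← h2]; ring
    _ ≤ (1 + l) * (8 * l) ^ c * 8 ^ c := by
        gcongr
        linarith
    _ = _ := by rw [h3]; ring

lemma s7_main_u (N : ℕ) (hN : 2 ≤ N) (s : ℕ) (z : ℕ → ℤ)
    (hz : ∀ j ∈ Icc 1 s, IsCoprime (N : ℤ) (z j)) (u : Finset ℕ) (hu : u ⊆ Icc 1 s) (hne : u ≠ ∅) :
    N * s7M N s z u + N * Real.log 4 ^ u.card ≤
      (1 + Real.log N) * (64 * Real.log N) ^ u.card +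
      ∑ k ∈ Ico 1 N, ∏ j ∈ u, lsin ((k : ℝ) * (z j : ℝ) / N) := by
  have hlog2 : Real.log 2 ≤ Real.log N := Real.log_le_log (by norm_num) (by exact_mod_cast hN)
  have h2 := Real.log_two_gt_d9
  have h4 : Real.log 4 = 2 * Real.log 2 := by
    rw [show (4 : ℝ) = 2 ^ 2 by norm_num, Real.log_pow]; norm_num
  refine (s7_M_bound N (by omega) s z u hu hne).trans ?_
  rw [range_eq_Ico, sum_eq_sum_Ico_succ_bot (by omega : 0 < N)]
  have hS0 : s7S N 0 ≤ 2 * (1 + Real.log N) := by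
    have := s7_harm N hN
    simp only [s7S, mul_zero, Real.cos_zero, mul_one]
    calc ∑ m ∈ Ico 1 N, (2 : ℝ) / m = 2 * ∑ m ∈ Ico 1 N, (1 : ℝ) / m := by
          rw [mul_sum]; apply sum_congr rfl; intros; ring
      _ ≤ _ := by linarith
  have hS0' : 0 ≤ s7S N 0 := by
    simp only [s7S, mul_zero, Real.cos_zero, mul_one]
    exact sum_nonneg fun _ _ => by positivity
  have hk0 : ∏ j ∈ u, (Real.log 4 + s7S N (((0 : ℕ) : ℝ) * (z j : ℝ) / N)) ≤
      (8 * Real.log N) ^ u.card := by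
    simp only [Nat.cast_zero, zero_mul, zero_div, prod_const]
    apply pow_le_pow_left₀ <;> linarith
  have hdiff : ∑ k ∈ Ico 1 N, ∏ j ∈ u, (Real.log 4 + s7S N ((k : ℝ) * (z j : ℝ) / N))
      - ∑ k ∈ Ico 1 N, ∏ j ∈ u, lsin ((k : ℝ) * (z j : ℝ) / N) ≤
      u.card * (2 * (1 + Real.log N)) * (4 * Real.log N) ^ u.card := by
    rw [← sum_sub_distrib]
    calc _ ≤ ∑ k ∈ Ico 1 N, (∑ j ∈ u, |Real.log 4 + s7S N ((k : ℝ) * (z j : ℝ) / N)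
          - lsin ((k : ℝ) * (z j : ℝ) / N)|) * (4 * Real.log N) ^ u.card := by
          apply sum_le_sum
          intro k hk
          refine (le_abs_self _).trans (s7_prod_diff u _ _ _ (by linarith) ?_ ?_)
          · intro j hj
            obtain ⟨_, _, h5, h6⟩ := s7_facts N (z j) (hz j (hu hj)) k hk
            rw [abs_of_nonneg h5]
            linarith
          · intro j hj
            obtain ⟨_, h7, h5, h6⟩ := s7_facts N (z j) (hz j (hu hj)) k hk
            rw [abs_le] at h7 ⊢
            constructor <;> linarith
      _ = (∑ j ∈ u, ∑ k ∈ Ico 1 N, |Real.log 4 + s7S N ((k : ℝ) * (z j : ℝ) / N)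
          - lsin ((k : ℝ) * (z j : ℝ) / N)|) * (4 * Real.log N) ^ u.card := by
          rw [← sum_mul, sum_comm]
      _ ≤ _ := by
          have : 0 ≤ Real.log N := by linarith
          gcongr
          rw [← nsmul_eq_mul]
          exact sum_le_card_nsmul _ _ _ fun j hj => s7_sum_err N hN (z j) (hz j (hu hj))
  have hf := s7_final u.card (card_pos.2 (nonempty_iff_ne_empty.2 hne)) (Real.log N) (by linarith)
  simp only [zero_add]
  linarith

/-- Theorem 6, first part: there is an absolute constant `a > 0`
such that for all `n ≥ 1`, `N = 2^n`, all `s`, all strictly positive weights `γ` and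
every `z ∈ {1,…,N-1}^s` with `gcd(z_j,N) = 1` satisfying
`H_{s,n,γ}(z) ≤ N ∑_{∅≠v⊆{1:s}} (log 4)^{|v|} γ_v`, one has
`T_{1,γ}(N,z) ≤ (1 + log N) ∑_{∅≠u⊆{1:s}} (γ_u/N)(a log N)^{|u|}`. -/
theorem statement7 :
    ∃ a : ℝ, 0 < a ∧
      ∀ (n s : ℕ), 1 ≤ n → 1 ≤ s →
        ∀ γ : Finset ℕ → ℝ, (∀ u, 0 < γ u) → γ ∅ = 1 →
          ∀ z : ℕ → ℤ,
            (∀ j ∈ Finset.Icc 1 s, 1 ≤ z j ∧ z j ≤ 2 ^ n - 1) →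
            (∀ j ∈ Finset.Icc 1 s, Int.gcd (z j) ((2 : ℤ) ^ n) = 1) →
            Hsum γ s n z ≤
              2 ^ n * ∑ v ∈ (Finset.Icc 1 s).powerset.filter (· ≠ ∅),
                Real.log 4 ^ v.card * γ v →
            Tsum 1 γ (2 ^ n) s z ≤
              (1 + Real.log (2 ^ n)) *
                ∑ u ∈ (Finset.Icc 1 s).powerset.filter (· ≠ ∅),
                  γ u / 2 ^ n * (a * Real.log (2 ^ n)) ^ u.card := by
  refine ⟨64, by norm_num, ?_⟩
  intro n s hn hs γ hγ _ z _ hz hH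
  have hN : 2 ≤ 2 ^ n := by
    calc 2 = 2 ^ 1 := rfl
      _ ≤ 2 ^ n := Nat.pow_le_pow_right (by norm_num) hn
  have hz' : ∀ j ∈ Icc 1 s, IsCoprime (((2 ^ n : ℕ) : ℤ)) (z j) := by
    intro j hj
    have := hz j hj
    rw [isCoprime_comm, Int.isCoprime_iff_gcd_eq_one]
    exact_mod_cast this
  rw [s7_T (2 ^ n) (by omega)]
  have hpos : (0 : ℝ) < 2 ^ n := by positivity
  have hHs : Hsum γ s n z = ∑ u ∈ (Finset.Icc 1 s).powerset.filter (· ≠ ∅),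
      γ u * ∑ k ∈ Ico (1 : ℕ) (2 ^ n), ∏ j ∈ u, lsin ((k : ℝ) * (z j : ℝ) / ((2 ^ n : ℕ) : ℝ)) := by
    have hI : Icc (1 : ℕ) (2 ^ n - 1) = Ico (1 : ℕ) (2 ^ n) := by
      ext k
      simp only [mem_Icc, mem_Ico]
      omega
    rw [Hsum, hI, sum_comm]
    apply sum_congr rfl
    intro u _
    rw [mul_sum]
    push_cast
    rfl
  rw [hHs] at hH
  have hsum : ∑ u ∈ (Finset.Icc 1 s).powerset.filter (· ≠ ∅),
      γ u * (((2 ^ n : ℕ) : ℝ) * s7M (2 ^ n) s z u + ((2 ^ n : ℕ) : ℝ) * Real.log 4 ^ u.card) ≤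
      ∑ u ∈ (Finset.Icc 1 s).powerset.filter (· ≠ ∅),
      γ u * ((1 + Real.log ((2 ^ n : ℕ) : ℝ)) * (64 * Real.log ((2 ^ n : ℕ) : ℝ)) ^ u.card +
      ∑ k ∈ Ico (1 : ℕ) (2 ^ n), ∏ j ∈ u, lsin ((k : ℝ) * (z j : ℝ) / ((2 ^ n : ℕ) : ℝ))) := by
    apply sum_le_sum
    intro u hu
    simp only [mem_filter, mem_powerset] at hu
    exact mul_le_mul_of_nonneg_left (s7_main_u _ hN s z hz' u hu.1 hu.2) (hγ u).le
  simp only [mul_add, sum_add_distrib] at hsum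
  have e1 : ∑ u ∈ (Finset.Icc 1 s).powerset.filter (· ≠ ∅),
      γ u * (((2 ^ n : ℕ) : ℝ) * s7M (2 ^ n) s z u) = 2 ^ n *
      ∑ u ∈ (Finset.Icc 1 s).powerset.filter (· ≠ ∅), γ u * s7M (2 ^ n) s z u := by
    rw [mul_sum]; apply sum_congr rfl; intros; push_cast; ring
  have e2 : ∑ u ∈ (Finset.Icc 1 s).powerset.filter (· ≠ ∅),
      γ u * (((2 ^ n : ℕ) : ℝ) * Real.log 4 ^ u.card) = 2 ^ n *
      ∑ u ∈ (Finset.Icc 1 s).powerset.filter (· ≠ ∅), Real.log 4 ^ u.card * γ u := by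
    rw [mul_sum]; apply sum_congr rfl; intros; push_cast; ring
  have e3 : ∑ u ∈ (Finset.Icc 1 s).powerset.filter (· ≠ ∅),
      γ u * ((1 + Real.log ((2 ^ n : ℕ) : ℝ)) * (64 * Real.log ((2 ^ n : ℕ) : ℝ)) ^ u.card) =
      2 ^ n * ((1 + Real.log (2 ^ n)) *
        ∑ u ∈ (Finset.Icc 1 s).powerset.filter (· ≠ ∅),
          γ u / 2 ^ n * (64 * Real.log (2 ^ n)) ^ u.card) := by
    rw [mul_sum, mul_sum]; apply sum_congr rfl; intros; push_cast; field_simp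
  rw [e1, e2, e3] at hsum
  refine le_of_mul_le_mul_left ?_ hpos
  linarith

end
end
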